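/- Assume the AG₂ setup and the definition of the operator D₁ below. If p ∈ R^a_{AG₂}, then there exists q ∈ R^a_{AG₂} such that q(z) = D₁p(z) for every D₁-regular z ∈ ℂ². In other words, the generalised Macdonald–Ruijsenaars operator D₁ preserves the ring R^a_{AG₂} of analytic quasi-invariants. -/

import Mathlib

noncomputable section

open Complex

/-- The bilinear extension of the Euclidean inner product on `ℂ²`. -/
def bil (z w : Fin 2 → ℂ) : ℂ := z 0 * w 0 + z 1 * w 1

/-- `√3` as a complex number. -/
def rt3 : ℂ := (Real.sqrt 3 : ℝ)

def vα₁ : Fin 2 → ℂ := ![0, rt3]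
def vα₂ : Fin 2 → ℂ := ![-(3/2), rt3 / 2]
def vα₃ : Fin 2 → ℂ := ![3/2, rt3 / 2]
def vβ₁ : Fin 2 → ℂ := ![1, 0]
def vβ₂ : Fin 2 → ℂ := ![1/2, rt3 / 2]
def vβ₃ : Fin 2 → ℂ := ![-(1/2), rt3 / 2]

/-- Positive roots of `G₂`: `α₁, α₂, α₃, β₁, β₂, β₃`. -/
def G2plus : List (Fin 2 → ℂ) := [vα₁, vα₂, vα₃, vβ₁, vβ₂, vβ₃]
/-- The six short roots `±βᵢ` of `G₂`. -/
def shortRoots : List (Fin 2 → ℂ) := [vβ₁, vβ₂, vβ₃, -vβ₁, -vβ₂, -vβ₃]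
/-- The six long roots `±αᵢ` of `G₂`. -/
def longRoots : List (Fin 2 → ℂ) := [vα₁, vα₂, vα₃, -vα₁, -vα₂, -vα₃]
/-- All twelve roots of `G₂`. -/
def G2all : List (Fin 2 → ℂ) := longRoots ++ shortRoots
/-- The twelve vectors `2γ`, `γ ∈ G₂`. -/
def twoG2 : List (Fin 2 → ℂ) := G2all.map (fun γ => (2 : ℂ) • γ)
/-- The six vectors `±2βⱼ`. -/
def twoShort : List (Fin 2 → ℂ) := shortRoots.map (fun γ => (2 : ℂ) • γ)
/-- The six vectors `±2αⱼ`. -/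
def twoLong : List (Fin 2 → ℂ) := longRoots.map (fun γ => (2 : ℂ) • γ)
/-- The six vectors `±4βⱼ`. -/
def fourShort : List (Fin 2 → ℂ) := shortRoots.map (fun γ => (4 : ℂ) • γ)
/-- The eighteen vectors `2γ`, `γ ∈ AG₂`. -/
def twoAG2 : List (Fin 2 → ℂ) := twoG2 ++ fourShort

/-- The quasi-invariance conditions for the configuration `AG₂` with
multiplicities `m_{αᵢ} = m`, `m_{βᵢ} = 3m`, `m_{2βᵢ} = 1`. -/
def QuasiInvAG2 (m : ℕ) (ψ : (Fin 2 → ℂ) → ℂ) : Prop :=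
  (∀ α ∈ [vα₁, vα₂, vα₃], ∀ s : ℕ, 1 ≤ s → s ≤ m →
    ∀ z : Fin 2 → ℂ, bil α z = 0 →
      ψ (z + (s : ℂ) • α) = ψ (z - (s : ℂ) • α)) ∧
  (∀ β ∈ [vβ₁, vβ₂, vβ₃], ∀ s : ℕ, ((1 ≤ s ∧ s ≤ 3 * m) ∨ s = 3 * m + 2) →
    ∀ z : Fin 2 → ℂ, bil β z = 0 →
      ψ (z + (s : ℂ) • β) = ψ (z - (s : ℂ) • β))

/-- The linear form `z ↦ ⟨γ, z⟩` as a polynomial in `z₁, z₂`. -/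
def linForm (γ : Fin 2 → ℂ) : MvPolynomial (Fin 2) ℂ :=
  MvPolynomial.C (γ 0) * MvPolynomial.X 0 + MvPolynomial.C (γ 1) * MvPolynomial.X 1

/-- The highest-order term `∏ᵢ ⟨αᵢ,z⟩^m ⟨βᵢ,z⟩^{3m} ⟨2βᵢ,z⟩` of the polynomial
part of the Baker–Akhiezer function for `AG₂`. -/
def topTerm (m : ℕ) : MvPolynomial (Fin 2) ℂ :=
  (linForm vα₁ * linForm vα₂ * linForm vα₃) ^ m *
    (linForm vβ₁ * linForm vβ₂ * linForm vβ₃) ^ (3 * m) *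
    (linForm ((2 : ℂ) • vβ₁) * linForm ((2 : ℂ) • vβ₂) * linForm ((2 : ℂ) • vβ₃))

/-- A Baker–Akhiezer function for `AG₂` at `x`. -/
def IsBAFunction (m : ℕ) (x : Fin 2 → ℂ) (ψ : (Fin 2 → ℂ) → ℂ) : Prop :=
  ∃ P : MvPolynomial (Fin 2) ℂ,
    P.totalDegree = 12 * m + 3 ∧
    MvPolynomial.homogeneousComponent (12 * m + 3) P = topTerm m ∧
    (∀ z, ψ z = MvPolynomial.eval z P * Complex.exp (bil z x)) ∧
    QuasiInvAG2 m ψ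

/-- `z` is `D₁`-regular: `⟨γ,z⟩ ∉ {0, ±γ², ±2γ²}` for every `γ ∈ G₂₊`. -/
def D1Reg (z : Fin 2 → ℂ) : Prop :=
  ∀ γ ∈ G2plus, bil γ z ≠ 0 ∧ bil γ z ≠ bil γ γ ∧ bil γ z ≠ -bil γ γ ∧
    bil γ z ≠ 2 * bil γ γ ∧ bil γ z ≠ -(2 * bil γ γ)

open scoped Classical in
/-- The coefficient functions `a_τ` (for `τ/2 ∈ G₂`) of the dual
Macdonald–Ruijsenaars operator `D₁` for `AG₂`. -/
noncomputable def aD1 (m : ℕ) (τ z : Fin 2 → ℂ) : ℂ :=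
  let h : Fin 2 → ℂ := (2⁻¹ : ℂ) • τ
  if τ ∈ twoShort then
    3 *
      ((shortRoots.filter (fun γ => bil τ γ = bil γ γ)).map (fun γ =>
        (1 - (3 * (m : ℂ) + 2) * bil γ γ / bil γ z) *
        (1 + 3 * (m : ℂ) * bil γ γ / (bil γ z + 2 * bil γ γ)) *
        (1 - (3 * (m : ℂ) - 1) * bil γ γ / (bil γ z - bil γ γ)))).prod *
      ((longRoots.filter (fun γ => bil τ γ = bil γ γ)).map (fun γ =>
        1 - (m : ℂ) * bil γ γ / bil γ z)).prod *
      ((1 - (3 * (m : ℂ) + 2) * bil h h / bil h z) *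
        (1 - 3 * (m : ℂ) * bil h h / (bil h z + bil h h)))
  else
    ((shortRoots.filter (fun γ => bil τ γ = 3 * bil γ γ)).map (fun γ =>
        (1 - (3 * (m : ℂ) + 2) * bil γ γ / bil γ z) *
        (1 - (3 * (m : ℂ) + 1) * bil γ γ / (bil γ z + bil γ γ)) *
        (1 - 3 * (m : ℂ) * bil γ γ / (bil γ z + 2 * bil γ γ)))).prod *
      ((longRoots.filter (fun γ => bil τ γ = bil γ γ)).map (fun γ =>
        1 - (m : ℂ) * bil γ γ / bil γ z)).prod *
      ((1 - (m : ℂ) * bil h h / bil h z) *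
        (1 - (m : ℂ) * bil h h / (bil h z + bil h h)))

/-- The value `D₁p(z) = ∑_{τ : τ/2 ∈ G₂} a_τ(z)(p(z+τ) − p(z))`. -/
noncomputable def applyD1 (m : ℕ) (p : (Fin 2 → ℂ) → ℂ) (z : Fin 2 → ℂ) : ℂ :=
  (twoG2.map (fun τ => aD1 m τ z * (p (z + τ) - p z))).sum

/-- The ring `R^a_{AG₂}` of analytic quasi-invariants for `AG₂`. -/
def RaAG2 (m : ℕ) (p : (Fin 2 → ℂ) → ℂ) : Prop :=
  (∀ z, AnalyticAt ℂ p z) ∧ QuasiInvAG2 m p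

open Filter Topology

set_option linter.unusedSimpArgs false

theorem tele_multilin {E : Type*} [NormedAddCommGroup E] [NormedSpace ℂ E] (n : ℕ)
    (f : ContinuousMultilinearMap ℂ (fun _ : Fin (n+1) => E) ℂ) (u v : E) :
    f (fun _ => u) - f (fun _ => v) =
      ∑ k : Fin (n+1), f (fun i => if i < k then v else if i = k then u - v else u) := by
  have key : ∀ k : Fin (n+1), f (fun i => if i < k then v else if i = k then u - v else u)
      = f (fun i => if i.val < k.val then v else u) - f (fun i => if i.val < k.val + 1 then v else u) := by
    intro k
    have h := f.toMultilinearMap.map_update_sub (fun i => if i.val < k.val then v else u) k u v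
    have e1 : (fun i : Fin (n+1) => if i < k then v else if i = k then u - v else u)
      = Function.update (fun i => if i.val < k.val then v else u) k (u - v) := by
      funext i
      by_cases hi : i = k
      · subst hi; simp
      · simp [Function.update_of_ne hi, hi]
    have e2 : (fun i : Fin (n+1) => if i.val < k.val then v else u)
      = Function.update (fun i => if i.val < k.val then v else u) k u := by
      funext i
      by_cases hi : i = k
      · subst hi; simp
      · simp [Function.update_of_ne hi]
    have e3 : (fun i : Fin (n+1) => if i.val < k.val + 1 then v else u)
      = Function.update (fun i => if i.val < k.val then v else u) k v := by
      funext i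
      by_cases hi : i = k
      · subst hi; simp
      · have : i.val ≠ k.val := fun h => hi (Fin.ext h)
        have h2 : i.val < k.val + 1 ↔ i.val < k.val := by omega
        simp [Function.update_of_ne hi, h2]
    rw [e1, e3]
    nth_rewrite 2 [e2]
    exact h
  rw [Finset.sum_congr rfl (fun k _ => key k),
    Fin.sum_univ_eq_sum_range (fun k => f (fun i : Fin (n+1) => if i.val < k then v else u) - f (fun i : Fin (n+1) => if i.val < k + 1 then v else u)) (n+1),
    Finset.sum_range_sub']
  have : (fun i : Fin (n+1) => if i.val < n+1 then v else u) = fun _ => v := by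
    funext i; exact if_pos i.isLt
  rw [this]; simp only [not_lt_zero, if_false]

/-- local division -/
theorem local_div {E : Type*} [NormedAddCommGroup E] [NormedSpace ℂ E] (F : E → ℂ) (l : E →L[ℂ] ℂ)
    (e : E) (z0 : E) (hF : AnalyticAt ℂ F z0)
    (h0 : ∀ z, F (z0 + (z - l z • e)) = 0) :
    ∃ q : E → ℂ, AnalyticAt ℂ q z0 ∧ ∀ᶠ z in 𝓝 z0, F z = l (z - z0) * q z := by
  obtain ⟨p, r, hp⟩ := hF
  let π : E →L[ℂ] E := ContinuousLinearMap.id ℂ E - l.smulRight e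
  have hπ : ∀ z, π z = z - l z • e := fun z => by simp [π]
  obtain ⟨a, ha0, har⟩ := ENNReal.lt_iff_exists_nnreal_btwn.1 hp.r_pos
  have ha : (0:ℝ) < a := by exact_mod_cast ha0
  obtain ⟨C, hC, hpC⟩ := p.norm_mul_pow_le_of_lt_radius (lt_of_lt_of_le har hp.r_le)
  set M : ℝ := 1 + ‖π‖ with hM
  have hM1 : 1 ≤ M := by simp [hM]
  let c : ∀ n : ℕ, Fin (n+1) → ContinuousMultilinearMap ℂ (fun _ : Fin n => E) ℂ := fun n k =>
    ContinuousMultilinearMap.curryMid (Ei := fun _ => E) k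
      ((p (n+1)).compContinuousLinearMap (fun i => if i < k then π else ContinuousLinearMap.id ℂ E)) e
  let q : FormalMultilinearSeries ℂ E ℂ := fun n => ∑ k, c n k
  have hc : ∀ n k, ‖c n k‖ ≤ ‖p (n+1)‖ * M^(n+1) * ‖e‖ := by
    intro n k
    refine (ContinuousLinearMap.le_opNorm _ _).trans ?_
    rw [ContinuousMultilinearMap.norm_curryMid]
    gcongr
    refine (ContinuousMultilinearMap.norm_compContinuousLinearMap_le _ _).trans ?_
    gcongr
    calc _ ≤ ∏ i : Fin (n+1), M := by
            refine Finset.prod_le_prod (fun i _ => norm_nonneg _) (fun i _ => ?_)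
            split_ifs
            · simp [hM]
            · exact (ContinuousLinearMap.norm_id_le).trans hM1
      _ = _ := by simp
  have hqn : ∀ n, ‖q n‖ ≤ (n+1) * (‖p (n+1)‖ * M^(n+1) * ‖e‖) := by
    intro n
    refine (norm_sum_le _ _).trans ((Finset.sum_le_sum (fun k _ => hc n k)).trans ?_)
    simp
  have hMpos : 0 < M := by linarith
  let ρ : NNReal := ⟨a / (2*M), by positivity⟩
  have hρ : (ρ:ℝ) = a / (2*M) := rfl
  have hrad : (ρ : ENNReal) ≤ q.radius := by
    refine q.le_radius_of_bound (C * M * ‖e‖ / a) (fun n => ?_)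
    have h1 := hpC (n+1)
    have h2 : ((n:ℝ)+1) ≤ 2^n := by exact_mod_cast Nat.lt_two_pow_self
    calc ‖q n‖ * (ρ:ℝ)^n ≤ ((n+1) * (‖p (n+1)‖ * M^(n+1) * ‖e‖)) * (a/(2*M))^n := by
          rw [hρ]; gcongr; exact hqn n
      _ = ((n+1)/2^n) * ((‖p (n+1)‖ * a^(n+1)) * M * ‖e‖ / a) := by
          rw [div_pow, mul_pow, pow_succ M, pow_succ (a:ℝ)]
          field_simp
      _ ≤ 1 * (C * M * ‖e‖ / a) := by
          gcongr
          rw [div_le_one (by positivity)]; exact h2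
      _ = _ := by ring
  have hρ0 : 0 < ρ := by
    have : (0:ℝ) < ρ := by rw [hρ]; positivity
    exact_mod_cast this
  have hqrad : 0 < q.radius := lt_of_lt_of_le (by exact_mod_cast hρ0) hrad
  have hqs := q.hasFPowerSeriesOnBall hqrad
  refine ⟨fun z => q.sum (z - z0), ?_, ?_⟩
  · have : HasFPowerSeriesOnBall (fun z => q.sum (z - z0)) q (0 + z0) q.radius := hqs.comp_sub z0
    rw [zero_add] at this
    exact this.analyticAt
  · have hev : ∀ᶠ z in 𝓝 z0, ‖z - z0‖ < ρ := by
      have : ContinuousAt (fun z => ‖z - z0‖) z0 := by fun_prop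
      refine this.eventually_lt continuousAt_const ?_
      simpa using hρ0
    filter_upwards [hev] with z hz
    set w := z - z0 with hw
    have hρa : (ρ:ℝ) * M ≤ a := by
      rw [hρ]
      have : (a:ℝ) / (2*M) * M = a/2 := by field_simp
      rw [this]; linarith
    have hwa : ‖w‖ < a := by nlinarith [norm_nonneg w]
    have hπa : ‖π w‖ < a := by
      have := π.le_opNorm w
      have h3 : ‖π‖ ≤ M := by simp [hM]
      nlinarith [norm_nonneg w, norm_nonneg π]
    have mem : ∀ v : E, ‖v‖ < a → v ∈ Metric.eball (0:E) r := by
      intro v hv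
      rw [Metric.mem_eball, edist_zero_right]
      refine lt_trans ?_ har
      rw [← ofReal_norm, ENNReal.ofReal_lt_coe_iff (norm_nonneg _)]
      exact hv
    have s1 := hp.hasSum (mem w hwa)
    have s2 := hp.hasSum (mem _ hπa)
    rw [hπ, h0, ← hπ] at s2
    have s3 := s1.sub s2
    rw [sub_zero] at s3
    have s4 : HasSum (fun n => (p (n+1) (fun _ => w) - p (n+1) (fun _ => π w))) (F (z0 + w)) := by
      have := (hasSum_nat_add_iff' (f := fun n => p n (fun _ => w) - p n (fun _ => π w)) 1).2 s3
      simp only [Finset.range_one, Finset.sum_singleton] at this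
      have e0 : (p 0 fun _ => w) = (p 0 fun _ => π w) := by
        congr 1; funext i; exact i.elim0
      rw [e0, sub_self, sub_zero] at this
      exact this
    have s5 : HasSum (fun n => l w * q n (fun _ => w)) (l w * q.sum (0 + w)) := by
      rw [zero_add]
      refine (q.hasSum (x := w) ?_).mul_left _
      rw [Metric.mem_eball, edist_zero_right]
      refine lt_of_lt_of_le ?_ hrad
      rw [← ofReal_norm, ENNReal.ofReal_lt_coe_iff (norm_nonneg _)]
      exact hz
    have e6 : ∀ n, (p (n+1) (fun _ => w) - p (n+1) (fun _ => π w)) = l w * q n (fun _ => w) := by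
      intro n
      rw [tele_multilin]
      simp only [q, ContinuousMultilinearMap.sum_apply, Finset.mul_sum]
      refine Finset.sum_congr rfl (fun k _ => ?_)
      simp only [c, ContinuousMultilinearMap.curryMid_apply, ContinuousMultilinearMap.compContinuousLinearMap_apply]
      have e1 : (fun i : Fin (n+1) => if i < k then π w else if i = k then w - π w else w)
        = Function.update (fun i => if i < k then π w else w) k (l w • e) := by
        funext i
        by_cases hi : i = k
        · subst hi; simp [hπ]
        · simp [Function.update_of_ne hi, hi]
      rw [e1, ContinuousMultilinearMap.map_update_smul, smul_eq_mul]
      congr 2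
      funext i
      by_cases hi : i = k
      · subst hi; simp
      · obtain ⟨j, rfl⟩ := Fin.exists_succAbove_eq hi
        simp [Function.update_of_ne hi]
        split_ifs <;> simp
    simp_rw [e6] at s4
    have := s4.unique s5
    rw [zero_add] at this
    rw [← this, hw]; simp

theorem global_div {E : Type*} [NormedAddCommGroup E] [NormedSpace ℂ E] (F : E → ℂ) (l : E →L[ℂ] ℂ)
    (c : ℂ) (e : E) (he : l e = 1) (hF : ∀ z, AnalyticAt ℂ F z)
    (h0 : ∀ z, l z + c = 0 → F z = 0) :
    ∃ q : E → ℂ, (∀ z, AnalyticAt ℂ q z) ∧ ∀ z, F z = (l z + c) * q z := by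
  classical
  refine ⟨fun z => if l z + c = 0 then fderiv ℂ F z e else F z / (l z + c), ?_, ?_⟩
  · intro z0
    by_cases hz : l z0 + c = 0
    · obtain ⟨q, hq, hqe⟩ := local_div F l e z0 (hF z0) (fun z => h0 _ (by
        simp only [map_add, map_sub, map_smul, he, smul_eq_mul, mul_one, sub_self, add_zero]; exact hz))
      refine hq.congr ?_
      filter_upwards [hqe.eventually_nhds, hq.eventually_analyticAt] with z hz1 hz2
      have hl : ∀ w, l (w - z0) = l w + c := fun w => by
        rw [map_sub]; linear_combination -hz
      split_ifs with h
      · have h1 : F =ᶠ[𝓝 z] fun w => (l w + c) * q w := by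
          filter_upwards [hz1] with w hw
          rw [hw, hl]
        have h2 : HasFDerivAt (fun w => (l w + c) * q w) ((l z + c) • fderiv ℂ q z + q z • l) z := by
          exact (l.hasFDerivAt.add_const c).mul hz2.differentiableAt.hasFDerivAt
        rw [h1.fderiv_eq, h2.fderiv, h]
        simp [he]
      · rw [hz1.self_of_nhds, hl]
        field_simp
    · have : AnalyticAt ℂ (fun z => F z / (l z + c)) z0 :=
        (hF z0).div ((l.analyticAt z0).add analyticAt_const) hz
      refine this.congr ?_
      have hc : ContinuousAt (fun z => l z + c) z0 := by fun_prop
      filter_upwards [hc.eventually_ne hz] with z h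
      rw [if_neg h]
  · intro z
    by_cases hz : l z + c = 0
    · simp [hz, h0 z hz]
    · simp [hz]; field_simp

def lf (t : ℤ × ℤ × ℤ) (z : ℂ × ℂ) : ℂ := t.1 * z.1 + t.2.1 * z.2 + t.2.2

def lrel (t u : ℤ × ℤ × ℤ) : Prop :=
  t.1 * u.2.1 - t.2.1 * u.1 ≠ 0 ∨ (t.1 = u.1 ∧ t.2.1 = u.2.1 ∧ t.2.2 ≠ u.2.2)

instance : DecidableRel lrel := fun t u => by unfold lrel; infer_instance

theorem ev_affine_ne (a k v : ℂ) (h : k ≠ 0 ∨ a ≠ v) : ∀ᶠ e : ℂ in 𝓝[≠] 0, a + k * e ≠ v := by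
  by_cases hk : k = 0
  · have : a ≠ v := by tauto
    simp [hk, this]
  by_cases ha : a = v
  · filter_upwards [self_mem_nhdsWithin] with e he
    simpa [ha, hk] using he
  · have hc : ContinuousAt (fun e : ℂ => a + k * e) 0 := by fun_prop
    exact (hc.eventually_ne (by simpa using ha)).filter_mono nhdsWithin_le_nhds

theorem lf_analytic (t : ℤ × ℤ × ℤ) (z : ℂ × ℂ) : AnalyticAt ℂ (lf t) z := by
  unfold lf
  have h1 : AnalyticAt ℂ (fun z : ℂ × ℂ => z.1) z := analyticAt_fst
  have h2 : AnalyticAt ℂ (fun z : ℂ × ℂ => z.2) z := analyticAt_snd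
  fun_prop

theorem list_div (L : List (ℤ × ℤ × ℤ)) : ∀ (F : ℂ × ℂ → ℂ), (∀ z, AnalyticAt ℂ F z) →
    L.Pairwise lrel → (∀ t ∈ L, t.1 ≠ 0 ∨ t.2.1 ≠ 0) → (∀ t ∈ L, ∀ z, lf t z = 0 → F z = 0) →
    ∃ q : ℂ × ℂ → ℂ, (∀ z, AnalyticAt ℂ q z) ∧ ∀ z, F z = (L.map (fun t => lf t z)).prod * q z := by
  induction L with
  | nil => intro F hF _ _ _; exact ⟨F, hF, by simp⟩
  | cons t L ih =>
    intro F hF hpw hne h0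
    rw [List.pairwise_cons] at hpw
    have hl : ∃ q : ℂ × ℂ → ℂ, (∀ z, AnalyticAt ℂ q z) ∧ ∀ z, F z = lf t z * q z := by
      let l : ℂ × ℂ →L[ℂ] ℂ := (t.1 : ℂ) • ContinuousLinearMap.fst ℂ ℂ ℂ + (t.2.1 : ℂ) • ContinuousLinearMap.snd ℂ ℂ ℂ
      have hlf : ∀ z, l z + (t.2.2 : ℂ) = lf t z := fun z => by simp [l, lf]
      have : ∃ e, l e = 1 := by
        rcases hne t (by simp) with h | h
        · have : (t.1 : ℂ) ≠ 0 := by exact_mod_cast h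
          exact ⟨((t.1:ℂ)⁻¹, 0), by simp [l, this]⟩
        · have : (t.2.1 : ℂ) ≠ 0 := by exact_mod_cast h
          exact ⟨(0, (t.2.1:ℂ)⁻¹), by simp [l, this]⟩
      obtain ⟨e, he⟩ := this
      obtain ⟨q, hq, hq2⟩ := global_div F l t.2.2 e he hF (fun z hz => h0 t (by simp) z (by rw [← hlf]; exact hz))
      exact ⟨q, hq, fun z => by rw [hq2, hlf]⟩
    obtain ⟨q1, hq1, hq1F⟩ := hl
    obtain ⟨q, hq, hqe⟩ := ih q1 hq1 hpw.2 (fun u hu => hne u (by simp [hu])) (by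
      intro u hu z hz
      have hrel := hpw.1 u hu
      let path : ℂ → ℂ × ℂ := fun e => (z.1 + (-(u.2.1:ℂ)) * e, z.2 + (u.1 : ℂ) * e)
      have hpc : Tendsto (fun e => q1 (path e)) (𝓝[≠] 0) (𝓝 (q1 z)) := by
        have h1 : ContinuousAt path 0 := by fun_prop
        have h2 : path 0 = z := by simp [path]
        have h3 : ContinuousAt q1 (path 0) := (hq1 _).continuousAt
        have := (ContinuousAt.comp h3 h1).tendsto.mono_left (nhdsWithin_le_nhds (s := {0}ᶜ))
        simpa [h2, Function.comp_def] using this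
      have hz' := hz
      unfold lf at hz'
      have hev : ∀ᶠ e : ℂ in 𝓝[≠] 0, lf t (path e) ≠ 0 := by
        have h4 := ev_affine_ne (lf t z) ((u.1:ℂ) * t.2.1 - u.2.1 * t.1) 0 (by
          rcases hrel with h | ⟨h1, h2, h3⟩
          · left
            intro h5; apply h
            have : ((t.1 * u.2.1 - t.2.1 * u.1 : ℤ) : ℂ) = 0 := by push_cast; linear_combination -h5
            exact_mod_cast this
          · right
            intro h5; apply h3
            unfold lf at h5
            rw [h1, h2] at h5
            have : (t.2.2 : ℂ) = u.2.2 := by linear_combination h5 - hz'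
            exact_mod_cast this)
        filter_upwards [h4] with e he
        have : lf t (path e) = lf t z + ((u.1:ℂ) * t.2.1 - u.2.1 * t.1) * e := by
          simp only [lf, path]; ring
        rw [this]; exact he
      have hev2 : ∀ᶠ e : ℂ in 𝓝[≠] 0, q1 (path e) = 0 := by
        filter_upwards [hev] with e he
        have h5 : F (path e) = 0 := h0 u (by simp [hu]) _ (by
          simp only [lf, path]; linear_combination hz')
        rw [hq1F] at h5
        exact (mul_eq_zero.1 h5).resolve_left he
      exact tendsto_nhds_unique (hpc.congr' hev2) tendsto_const_nhds)
    refine ⟨q, hq, fun z => ?_⟩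
    rw [hq1F, hqe]; simp [mul_assoc]

/-! ### coefficient functions -/
noncomputable def fS (M u : ℂ) : ℂ := (u - 3*M - 2) * (u + 3*M + 2) * (u - 3*M) / (u * (u+2) * (u-1))
noncomputable def fT (M u : ℂ) : ℂ := (u - 3*M - 2) * (u + 1 - 3*M) / (u * (u+1))
noncomputable def fV (M u : ℂ) : ℂ := (u - 3*M - 2) * (u - 3*M) * (u + 2 - 3*M) / (u * (u+1) * (u+2))
noncomputable def fL (M w : ℂ) : ℂ := (w - 3*M) / w
noncomputable def fK (M w : ℂ) : ℂ := (w - 3*M) * (w + 3 - 3*M) / (w * (w+3))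

noncomputable def cb (M x y : ℂ) : ℂ := 3 * fS M y * fS M (x-y) * fL M (x+y) * fL M (2*x-y) * fT M x
noncomputable def ca (M x y : ℂ) : ℂ := fV M x * fV M y * fL M (2*y-x) * fL M (2*x-y) * fK M (x+y)

def SR (u : ℂ) : Prop := u ≠ 0 ∧ u ≠ -2 ∧ u ≠ 1
def TR (u : ℂ) : Prop := u ≠ 0 ∧ u ≠ -1
def VR (u : ℂ) : Prop := u ≠ 0 ∧ u ≠ -1 ∧ u ≠ -2
def KR (u : ℂ) : Prop := u ≠ 0 ∧ u ≠ -3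
def gs (u : ℂ) : Prop := u ≠ 0 ∧ u ≠ 1 ∧ u ≠ -1 ∧ u ≠ 2 ∧ u ≠ -2
def gl (u : ℂ) : Prop := u ≠ 0 ∧ u ≠ 3 ∧ u ≠ -3

theorem gs.neg {u : ℂ} (h : gs u) : gs (-u) := by
  obtain ⟨h1,h2,h3,h4,h5⟩ := h
  refine ⟨?_,?_,?_,?_,?_⟩ <;> (intro h; simp_all [neg_eq_iff_eq_neg])
theorem gl.neg {u : ℂ} (h : gl u) : gl (-u) := by
  obtain ⟨h1,h2,h3⟩ := h
  refine ⟨?_,?_,?_⟩ <;> (intro h; simp_all [neg_eq_iff_eq_neg])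
theorem gs.S {u : ℂ} (h : gs u) : SR u := ⟨h.1, h.2.2.2.2, h.2.1⟩
theorem gs.T {u : ℂ} (h : gs u) : TR u := ⟨h.1, h.2.2.1⟩
theorem gs.V {u : ℂ} (h : gs u) : VR u := ⟨h.1, h.2.2.1, h.2.2.2.2⟩
theorem gl.K {u : ℂ} (h : gl u) : KR u := ⟨h.1, h.2.2⟩
theorem gs.of {u v : ℂ} (h : gs u) (e : v = u) : gs v := e ▸ h
theorem gs.ofn {u v : ℂ} (h : gs u) (e : v = -u) : gs v := e ▸ h.neg
theorem gl.of {u v : ℂ} (h : gl u) (e : v = u) : gl v := e ▸ h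
theorem gl.ofn {u v : ℂ} (h : gl u) (e : v = -u) : gl v := e ▸ h.neg

theorem addne {u a b : ℂ} (h : u ≠ b) (e : a = -b) : u + a ≠ 0 := by
  intro h2; apply h; rw [e] at h2; linear_combination h2

theorem cS (M : ℂ) {u : ℂ} (h : SR u) : ContinuousAt (fS M) u := by
  unfold fS
  refine ContinuousAt.div (by fun_prop) (by fun_prop) ?_
  exact mul_ne_zero (mul_ne_zero h.1 (addne h.2.1 (by norm_num))) (sub_ne_zero.2 h.2.2)
theorem cT (M : ℂ) {u : ℂ} (h : TR u) : ContinuousAt (fT M) u := by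
  unfold fT
  refine ContinuousAt.div (by fun_prop) (by fun_prop) ?_
  exact mul_ne_zero h.1 (addne h.2 (by norm_num))
theorem cV (M : ℂ) {u : ℂ} (h : VR u) : ContinuousAt (fV M) u := by
  unfold fV
  refine ContinuousAt.div (by fun_prop) (by fun_prop) ?_
  exact mul_ne_zero (mul_ne_zero h.1 (addne h.2.1 (by norm_num))) (addne h.2.2 (by norm_num))
theorem cL (M : ℂ) {u : ℂ} (h : u ≠ 0) : ContinuousAt (fL M) u := by
  unfold fL
  exact ContinuousAt.div (by fun_prop) (by fun_prop) h
theorem cK (M : ℂ) {u : ℂ} (h : KR u) : ContinuousAt (fK M) u := by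
  unfold fK
  refine ContinuousAt.div (by fun_prop) (by fun_prop) ?_
  exact mul_ne_zero h.1 (addne h.2 (by norm_num))

section tends
variable {l : Filter ℂ} {X Y d : ℂ → ℂ} {x y r : ℂ} (M : ℂ)

theorem tsub (hX : Tendsto X l (𝓝 x)) (hY : Tendsto Y l (𝓝 y)) :
    Tendsto (fun e => X e - Y e) l (𝓝 (x - y)) := hX.sub hY
theorem tadd (hX : Tendsto X l (𝓝 x)) (hY : Tendsto Y l (𝓝 y)) :
    Tendsto (fun e => X e + Y e) l (𝓝 (x + y)) := hX.add hY
theorem t2s (hX : Tendsto X l (𝓝 x)) (hY : Tendsto Y l (𝓝 y)) :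
    Tendsto (fun e => 2 * X e - Y e) l (𝓝 (2 * x - y)) := (hX.const_mul 2).sub hY

theorem tb (hX : Tendsto X l (𝓝 x)) (hY : Tendsto Y l (𝓝 y))
    (h1 : TR x) (h2 : SR y) (h3 : SR (x-y)) (h4 : x + y ≠ 0) (h5 : 2*x-y ≠ 0) :
    Tendsto (fun e => cb M (X e) (Y e)) l (𝓝 (cb M x y)) :=
  (((((((cS M h2).tendsto.comp hY).const_mul 3).mul ((cS M h3).tendsto.comp (tsub hX hY))).mul
    ((cL M h4).tendsto.comp (tadd hX hY))).mul ((cL M h5).tendsto.comp (t2s hX hY))).mul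
    ((cT M h1).tendsto.comp hX))

theorem ta (hX : Tendsto X l (𝓝 x)) (hY : Tendsto Y l (𝓝 y))
    (h1 : VR x) (h2 : VR y) (h3 : KR (x+y)) (h4 : 2*y-x ≠ 0) (h5 : 2*x-y ≠ 0) :
    Tendsto (fun e => ca M (X e) (Y e)) l (𝓝 (ca M x y)) :=
  ((((((cV M h1).tendsto.comp hX)).mul ((cV M h2).tendsto.comp hY)).mul
    ((cL M h4).tendsto.comp (t2s hY hX))).mul ((cL M h5).tendsto.comp (t2s hX hY))).mul
    ((cK M h3).tendsto.comp (tadd hX hY))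

theorem tbT (hX : Tendsto X l (𝓝 x)) (hY : Tendsto Y l (𝓝 y))
    (h1 : Tendsto (fun e => d e * fT M (X e)) l (𝓝 r))
    (h2 : SR y) (h3 : SR (x-y)) (h4 : x + y ≠ 0) (h5 : 2*x-y ≠ 0) :
    Tendsto (fun e => d e * cb M (X e) (Y e)) l (𝓝 (3 * fS M y * fS M (x-y) * fL M (x+y) * fL M (2*x-y) * r)) :=
  ((((((((cS M h2).tendsto.comp hY).const_mul 3).mul ((cS M h3).tendsto.comp (tsub hX hY))).mul
    ((cL M h4).tendsto.comp (tadd hX hY))).mul ((cL M h5).tendsto.comp (t2s hX hY))).mul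
    h1)).congr (fun e => by simp only [cb, Function.comp]; ring)

theorem tbS1 (hX : Tendsto X l (𝓝 x)) (hY : Tendsto Y l (𝓝 y))
    (h2 : Tendsto (fun e => d e * fS M (Y e)) l (𝓝 r))
    (h1 : TR x) (h3 : SR (x-y)) (h4 : x + y ≠ 0) (h5 : 2*x-y ≠ 0) :
    Tendsto (fun e => d e * cb M (X e) (Y e)) l (𝓝 (3 * r * fS M (x-y) * fL M (x+y) * fL M (2*x-y) * fT M x)) :=
  ((((((h2.const_mul 3).mul ((cS M h3).tendsto.comp (tsub hX hY))).mul
    ((cL M h4).tendsto.comp (tadd hX hY))).mul ((cL M h5).tendsto.comp (t2s hX hY))).mul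
    ((cT M h1).tendsto.comp hX))).congr (fun e => by simp only [cb, Function.comp]; ring)

theorem tbS2 (hX : Tendsto X l (𝓝 x)) (hY : Tendsto Y l (𝓝 y))
    (h3 : Tendsto (fun e => d e * fS M (X e - Y e)) l (𝓝 r))
    (h1 : TR x) (h2 : SR y) (h4 : x + y ≠ 0) (h5 : 2*x-y ≠ 0) :
    Tendsto (fun e => d e * cb M (X e) (Y e)) l (𝓝 (3 * fS M y * r * fL M (x+y) * fL M (2*x-y) * fT M x)) :=
  (((((((cS M h2).tendsto.comp hY).const_mul 3).mul h3).mul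
    ((cL M h4).tendsto.comp (tadd hX hY))).mul ((cL M h5).tendsto.comp (t2s hX hY))).mul
    ((cT M h1).tendsto.comp hX)).congr (fun e => by simp only [cb, Function.comp]; ring)

theorem tbL1 (hX : Tendsto X l (𝓝 x)) (hY : Tendsto Y l (𝓝 y))
    (h4 : Tendsto (fun e => d e * fL M (X e + Y e)) l (𝓝 r))
    (h1 : TR x) (h2 : SR y) (h3 : SR (x-y)) (h5 : 2*x-y ≠ 0) :
    Tendsto (fun e => d e * cb M (X e) (Y e)) l (𝓝 (3 * fS M y * fS M (x-y) * r * fL M (2*x-y) * fT M x)) :=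
  (((((((cS M h2).tendsto.comp hY).const_mul 3).mul ((cS M h3).tendsto.comp (tsub hX hY))).mul
    h4).mul ((cL M h5).tendsto.comp (t2s hX hY))).mul
    ((cT M h1).tendsto.comp hX)).congr (fun e => by simp only [cb, Function.comp]; ring)

theorem tbL2 (hX : Tendsto X l (𝓝 x)) (hY : Tendsto Y l (𝓝 y))
    (h5 : Tendsto (fun e => d e * fL M (2 * X e - Y e)) l (𝓝 r))
    (h1 : TR x) (h2 : SR y) (h3 : SR (x-y)) (h4 : x + y ≠ 0) :
    Tendsto (fun e => d e * cb M (X e) (Y e)) l (𝓝 (3 * fS M y * fS M (x-y) * fL M (x+y) * r * fT M x)) :=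
  (((((((cS M h2).tendsto.comp hY).const_mul 3).mul ((cS M h3).tendsto.comp (tsub hX hY))).mul
    ((cL M h4).tendsto.comp (tadd hX hY))).mul h5).mul
    ((cT M h1).tendsto.comp hX)).congr (fun e => by simp only [cb, Function.comp]; ring)

theorem taV1 (hX : Tendsto X l (𝓝 x)) (hY : Tendsto Y l (𝓝 y))
    (h1 : Tendsto (fun e => d e * fV M (X e)) l (𝓝 r))
    (h2 : VR y) (h3 : KR (x+y)) (h4 : 2*y-x ≠ 0) (h5 : 2*x-y ≠ 0) :
    Tendsto (fun e => d e * ca M (X e) (Y e)) l (𝓝 (r * fV M y * fL M (2*y-x) * fL M (2*x-y) * fK M (x+y))) :=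
  ((((h1.mul ((cV M h2).tendsto.comp hY)).mul
    ((cL M h4).tendsto.comp (t2s hY hX))).mul ((cL M h5).tendsto.comp (t2s hX hY))).mul
    ((cK M h3).tendsto.comp (tadd hX hY))).congr (fun e => by simp only [ca, Function.comp]; ring)

theorem taV2 (hX : Tendsto X l (𝓝 x)) (hY : Tendsto Y l (𝓝 y))
    (h2 : Tendsto (fun e => d e * fV M (Y e)) l (𝓝 r))
    (h1 : VR x) (h3 : KR (x+y)) (h4 : 2*y-x ≠ 0) (h5 : 2*x-y ≠ 0) :
    Tendsto (fun e => d e * ca M (X e) (Y e)) l (𝓝 (fV M x * r * fL M (2*y-x) * fL M (2*x-y) * fK M (x+y))) :=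
  ((((((cV M h1).tendsto.comp hX)).mul h2).mul
    ((cL M h4).tendsto.comp (t2s hY hX))).mul ((cL M h5).tendsto.comp (t2s hX hY))).mul
    ((cK M h3).tendsto.comp (tadd hX hY)) |>.congr (fun e => by simp only [ca, Function.comp]; ring)

theorem taL1 (hX : Tendsto X l (𝓝 x)) (hY : Tendsto Y l (𝓝 y))
    (h4 : Tendsto (fun e => d e * fL M (2 * Y e - X e)) l (𝓝 r))
    (h1 : VR x) (h2 : VR y) (h3 : KR (x+y)) (h5 : 2*x-y ≠ 0) :
    Tendsto (fun e => d e * ca M (X e) (Y e)) l (𝓝 (fV M x * fV M y * r * fL M (2*x-y) * fK M (x+y))) :=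
  (((((((cV M h1).tendsto.comp hX)).mul ((cV M h2).tendsto.comp hY)).mul
    h4).mul ((cL M h5).tendsto.comp (t2s hX hY))).mul
    ((cK M h3).tendsto.comp (tadd hX hY))).congr (fun e => by simp only [ca, Function.comp]; ring)

theorem taL2 (hX : Tendsto X l (𝓝 x)) (hY : Tendsto Y l (𝓝 y))
    (h5 : Tendsto (fun e => d e * fL M (2 * X e - Y e)) l (𝓝 r))
    (h1 : VR x) (h2 : VR y) (h3 : KR (x+y)) (h4 : 2*y-x ≠ 0) :
    Tendsto (fun e => d e * ca M (X e) (Y e)) l (𝓝 (fV M x * fV M y * fL M (2*y-x) * r * fK M (x+y))) :=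
  (((((((cV M h1).tendsto.comp hX)).mul ((cV M h2).tendsto.comp hY)).mul
    ((cL M h4).tendsto.comp (t2s hY hX))).mul h5).mul
    ((cK M h3).tendsto.comp (tadd hX hY))).congr (fun e => by simp only [ca, Function.comp]; ring)

theorem taK (hX : Tendsto X l (𝓝 x)) (hY : Tendsto Y l (𝓝 y))
    (h3 : Tendsto (fun e => d e * fK M (X e + Y e)) l (𝓝 r))
    (h1 : VR x) (h2 : VR y) (h4 : 2*y-x ≠ 0) (h5 : 2*x-y ≠ 0) :
    Tendsto (fun e => d e * ca M (X e) (Y e)) l (𝓝 (fV M x * fV M y * fL M (2*y-x) * fL M (2*x-y) * r)) :=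
  (((((((cV M h1).tendsto.comp hX)).mul ((cV M h2).tendsto.comp hY)).mul
    ((cL M h4).tendsto.comp (t2s hY hX))).mul ((cL M h5).tendsto.comp (t2s hX hY))).mul
    h3).congr (fun e => by simp only [ca, Function.comp]; ring)
end tends

/-! ### residues -/
theorem res_general (f g : ℂ → ℂ) (D k : ℂ) (U : ℂ → ℂ) (hU : ∀ e, U e = D + k * e) (hk : k ≠ 0)
    (hfg : ∀ u, f u = g u / (u - D)) (hg : ContinuousAt g D) :
    Tendsto (fun e => e * f (U e)) (𝓝[≠] 0) (𝓝 (g D / k)) := by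
  have h1 : Tendsto (fun e : ℂ => g (D + k * e) / k) (𝓝[≠] 0) (𝓝 (g D / k)) := by
    have h2 : ContinuousAt (fun e : ℂ => D + k * e) 0 := by fun_prop
    have h3 : ContinuousAt g ((fun e : ℂ => D + k * e) 0) := by simpa using hg
    have h4 : ContinuousAt (fun e : ℂ => g (D + k * e)) 0 :=
      ContinuousAt.comp (f := fun e : ℂ => D + k * e) (g := g) h3 h2
    have := (h4.tendsto.mono_left (nhdsWithin_le_nhds (s := {0}ᶜ))).div_const k
    simpa using this
  refine h1.congr' ?_
  filter_upwards [self_mem_nhdsWithin] with e he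
  have he : e ≠ 0 := he
  rw [hU, hfg]
  have : D + k * e - D = k * e := by ring
  rw [this]; field_simp

section res
variable (M : ℂ) (k : ℂ) (U : ℂ → ℂ)
theorem rT0 (hU : ∀ e, U e = 0 + k * e) (hk : k ≠ 0) :
    Tendsto (fun e => e * fT M (U e)) (𝓝[≠] 0) (𝓝 ((-3*M-2)*(1-3*M)/k)) := by
  have := res_general (fT M) (fun u => (u - 3*M - 2) * (u + 1 - 3*M) / (u+1)) 0 k U hU hk
    (fun u => by simp only [fT, div_div]; congr 1; ring)
    (ContinuousAt.div (by fun_prop) (by fun_prop) (by norm_num))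
  convert this using 2; norm_num
theorem rTm1 (hU : ∀ e, U e = -1 + k * e) (hk : k ≠ 0) :
    ∃ r, Tendsto (fun e => e * fT M (U e)) (𝓝[≠] 0) (𝓝 r) := by
  exact ⟨_, res_general (fT M) (fun u => (u - 3*M - 2) * (u + 1 - 3*M) / u) (-1) k U hU hk
    (fun u => by simp only [fT, div_div]; congr 1; ring)
    (ContinuousAt.div (by fun_prop) (by fun_prop) (by norm_num))⟩
theorem rS0 (hU : ∀ e, U e = 0 + k * e) (hk : k ≠ 0) :
    Tendsto (fun e => e * fS M (U e)) (𝓝[≠] 0) (𝓝 ((-3*M-2)*(3*M+2)*(-3*M)/(-2)/k)) := by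
  have := res_general (fS M) (fun u => (u - 3*M - 2) * (u + 3*M + 2) * (u - 3*M) / ((u+2)*(u-1))) 0 k U hU hk
    (fun u => by simp only [fS, div_div]; congr 1; ring)
    (ContinuousAt.div (by fun_prop) (by fun_prop) (by norm_num))
  convert this using 2; norm_num
theorem rS1 (hU : ∀ e, U e = 1 + k * e) (hk : k ≠ 0) :
    Tendsto (fun e => e * fS M (U e)) (𝓝[≠] 0) (𝓝 ((-3*M-1)*(3*M+3)*(1-3*M)/3/k)) := by
  have := res_general (fS M) (fun u => (u - 3*M - 2) * (u + 3*M + 2) * (u - 3*M) / (u*(u+2))) 1 k U hU hk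
    (fun u => by simp only [fS, div_div])
    (ContinuousAt.div (by fun_prop) (by fun_prop) (by norm_num))
  convert this using 2; norm_num <;> ring
theorem rSm2 (hU : ∀ e, U e = -2 + k * e) (hk : k ≠ 0) :
    Tendsto (fun e => e * fS M (U e)) (𝓝[≠] 0) (𝓝 ((-3*M-4)*(3*M)*(-2-3*M)/6/k)) := by
  have := res_general (fS M) (fun u => (u - 3*M - 2) * (u + 3*M + 2) * (u - 3*M) / (u*(u-1))) (-2) k U hU hk
    (fun u => by simp only [fS, div_div]; congr 1; ring)
    (ContinuousAt.div (by fun_prop) (by fun_prop) (by norm_num))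
  convert this using 2; norm_num <;> ring
theorem rV0 (hU : ∀ e, U e = 0 + k * e) (hk : k ≠ 0) :
    Tendsto (fun e => e * fV M (U e)) (𝓝[≠] 0) (𝓝 ((-3*M-2)*(-3*M)*(2-3*M)/2/k)) := by
  have := res_general (fV M) (fun u => (u - 3*M - 2) * (u - 3*M) * (u + 2 - 3*M) / ((u+1)*(u+2))) 0 k U hU hk
    (fun u => by simp only [fV, div_div]; congr 1; ring)
    (ContinuousAt.div (by fun_prop) (by fun_prop) (by norm_num))
  convert this using 2; norm_num
theorem rVm1 (hU : ∀ e, U e = -1 + k * e) (hk : k ≠ 0) :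
    Tendsto (fun e => e * fV M (U e)) (𝓝[≠] 0) (𝓝 ((-3*M-3)*(-1-3*M)*(1-3*M)/(-1)/k)) := by
  have := res_general (fV M) (fun u => (u - 3*M - 2) * (u - 3*M) * (u + 2 - 3*M) / (u*(u+2))) (-1) k U hU hk
    (fun u => by simp only [fV, div_div]; congr 1; ring)
    (ContinuousAt.div (by fun_prop) (by fun_prop) (by norm_num))
  convert this using 2; norm_num <;> ring
theorem rVm2 (hU : ∀ e, U e = -2 + k * e) (hk : k ≠ 0) :
    Tendsto (fun e => e * fV M (U e)) (𝓝[≠] 0) (𝓝 ((-3*M-4)*(-2-3*M)*(-3*M)/2/k)) := by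
  have := res_general (fV M) (fun u => (u - 3*M - 2) * (u - 3*M) * (u + 2 - 3*M) / (u*(u+1))) (-2) k U hU hk
    (fun u => by simp only [fV, div_div]; congr 1; ring)
    (ContinuousAt.div (by fun_prop) (by fun_prop) (by norm_num))
  convert this using 2; norm_num <;> ring
theorem rL0 (hU : ∀ e, U e = 0 + k * e) (hk : k ≠ 0) :
    Tendsto (fun e => e * fL M (U e)) (𝓝[≠] 0) (𝓝 ((-3*M)/k)) := by
  have := res_general (fL M) (fun u => (u - 3*M)) 0 k U hU hk
    (fun u => by simp only [fL]; congr 1; ring)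
    (by fun_prop)
  convert this using 2; norm_num
theorem rK0 (hU : ∀ e, U e = 0 + k * e) (hk : k ≠ 0) :
    Tendsto (fun e => e * fK M (U e)) (𝓝[≠] 0) (𝓝 ((-3*M)*(3-3*M)/3/k)) := by
  have := res_general (fK M) (fun u => (u - 3*M) * (u + 3 - 3*M) / (u+3)) 0 k U hU hk
    (fun u => by simp only [fK, div_div]; congr 1; ring)
    (ContinuousAt.div (by fun_prop) (by fun_prop) (by norm_num))
  convert this using 2; norm_num
theorem rKm3 (hU : ∀ e, U e = -3 + k * e) (hk : k ≠ 0) :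
    ∃ r, Tendsto (fun e => e * fK M (U e)) (𝓝[≠] 0) (𝓝 r) := by
  exact ⟨_, res_general (fK M) (fun u => (u - 3*M) * (u + 3 - 3*M) / u) (-3) k U hU hk
    (fun u => by simp only [fK, div_div]; congr 1; ring)
    (ContinuousAt.div (by fun_prop) (by fun_prop) (by norm_num))⟩
end res

noncomputable def tm (P : ℂ × ℂ → ℂ) (C i j x y : ℂ) : ℂ := C * (P (x + i, y + j) - P (x, y))

noncomputable def opD (M : ℂ) (P : ℂ × ℂ → ℂ) (x y : ℂ) : ℂ :=
  tm P (cb M x y) 2 1 x y + tm P (cb M y (y-x)) 1 2 x y + tm P (cb M (y-x) (-x)) (-1) 1 x y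
  + tm P (cb M (-x) (-y)) (-2) (-1) x y + tm P (cb M (-y) (x-y)) (-1) (-2) x y + tm P (cb M (x-y) x) 1 (-1) x y
  + tm P (ca M x y) 3 3 x y + tm P (ca M y (y-x)) 0 3 x y + tm P (ca M (y-x) (-x)) (-3) 0 x y
  + tm P (ca M (-x) (-y)) (-3) (-3) x y + tm P (ca M (-y) (x-y)) 0 (-3) x y + tm P (ca M (x-y) x) 3 0 x y

section groups
variable {P : ℂ × ℂ → ℂ} {X Y C D : ℂ → ℂ} {x y i j i' j' A B φ φ' : ℂ}

theorem tP (hP : Continuous P) (hX : Tendsto X (𝓝[≠] 0) (𝓝 x)) (hY : Tendsto Y (𝓝[≠] 0) (𝓝 y)) :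
    Tendsto (fun e => P (X e, Y e)) (𝓝[≠] 0) (𝓝 (P (x, y))) :=
  (hP.tendsto (x, y)).comp (hX.prodMk_nhds hY)

theorem tPs (hP : Continuous P) (hX : Tendsto X (𝓝[≠] 0) (𝓝 x)) (hY : Tendsto Y (𝓝[≠] 0) (𝓝 y)) (i j : ℂ) :
    Tendsto (fun e => P (X e + i, Y e + j)) (𝓝[≠] 0) (𝓝 (P (x + i, y + j))) :=
  tP hP (hX.add_const i) (hY.add_const j)

theorem te : Tendsto (fun e : ℂ => e) (𝓝[≠] 0) (𝓝 0) := tendsto_id.mono_left nhdsWithin_le_nhds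

theorem g1reg (hP : Continuous P) (hX : Tendsto X (𝓝[≠] 0) (𝓝 x)) (hY : Tendsto Y (𝓝[≠] 0) (𝓝 y))
    (hC : Tendsto C (𝓝[≠] 0) (𝓝 A)) :
    Tendsto (fun e => e * tm P (C e) i j (X e) (Y e)) (𝓝[≠] 0) (𝓝 0) := by
  have := te.mul (hC.mul ((tPs hP hX hY i j).sub (tP hP hX hY)))
  rw [zero_mul] at this
  exact this

theorem g1single (hP : Continuous P) (hX : Tendsto X (𝓝[≠] 0) (𝓝 x)) (hY : Tendsto Y (𝓝[≠] 0) (𝓝 y))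
    (hC : Tendsto (fun e => e * C e) (𝓝[≠] 0) (𝓝 A)) (h : P (x + i, y + j) = P (x, y)) :
    Tendsto (fun e => e * tm P (C e) i j (X e) (Y e)) (𝓝[≠] 0) (𝓝 0) := by
  have := hC.mul ((tPs hP hX hY i j).sub (tP hP hX hY))
  rw [h, sub_self, mul_zero] at this
  exact this.congr (fun e => by simp only [tm]; ring)

theorem g1pair (hP : Continuous P) (hX : Tendsto X (𝓝[≠] 0) (𝓝 x)) (hY : Tendsto Y (𝓝[≠] 0) (𝓝 y))
    (hC : Tendsto (fun e => e * C e) (𝓝[≠] 0) (𝓝 A)) (hD : Tendsto (fun e => e * D e) (𝓝[≠] 0) (𝓝 B))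
    (hAB : A + B = 0) (h : A = 0 ∨ P (x + i', y + j') = P (x + i, y + j)) :
    Tendsto (fun e => e * (tm P (C e) i j (X e) (Y e) + tm P (D e) i' j' (X e) (Y e))) (𝓝[≠] 0) (𝓝 0) := by
  have := (hC.mul ((tPs hP hX hY i j).sub (tP hP hX hY))).add (hD.mul ((tPs hP hX hY i' j').sub (tP hP hX hY)))
  have e0 : A * (P (x + i, y + j) - P (x, y)) + B * (P (x + i', y + j') - P (x, y)) = 0 := by
    have hB : B = -A := by linear_combination hAB
    rcases h with h | h
    · rw [hB, h]; ring
    · rw [hB, h]; ring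
  rw [e0] at this
  exact this.congr (fun e => by simp only [tm]; ring)

theorem g2reg (hP : Continuous P) (hX : Tendsto X (𝓝[≠] 0) (𝓝 x)) (hY : Tendsto Y (𝓝[≠] 0) (𝓝 y))
    (hC : Tendsto C (𝓝[≠] 0) (𝓝 A)) (h0 : P (x, y) = 0) (h : P (x + i, y + j) = 0 ∨ A = 0) :
    Tendsto (fun e => tm P (C e) i j (X e) (Y e)) (𝓝[≠] 0) (𝓝 0) := by
  have := (hC.mul ((tPs hP hX hY i j).sub (tP hP hX hY)))
  have e0 : A * (P (x + i, y + j) - P (x, y)) = 0 := by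
    rcases h with h | h <;> simp [h, h0]
  rw [e0] at this
  exact this

theorem g2single (hC : Tendsto (fun e => e * C e) (𝓝[≠] 0) (𝓝 A))
    (hs : Tendsto (fun e => P (X e + i, Y e + j) / e) (𝓝[≠] 0) (𝓝 φ))
    (h0 : Tendsto (fun e => P (X e, Y e) / e) (𝓝[≠] 0) (𝓝 φ)) :
    Tendsto (fun e => tm P (C e) i j (X e) (Y e)) (𝓝[≠] 0) (𝓝 0) := by
  have := hC.mul (hs.sub h0)
  rw [sub_self, mul_zero] at this
  refine this.congr' ?_
  filter_upwards [self_mem_nhdsWithin] with e he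
  have he : e ≠ 0 := he
  simp only [tm]; field_simp

theorem g2pair (hC : Tendsto (fun e => e * C e) (𝓝[≠] 0) (𝓝 A))
    (hD : Tendsto (fun e => e * D e) (𝓝[≠] 0) (𝓝 B)) (hAB : A + B = 0)
    (hs : Tendsto (fun e => P (X e + i, Y e + j) / e) (𝓝[≠] 0) (𝓝 φ))
    (hs' : Tendsto (fun e => P (X e + i', Y e + j') / e) (𝓝[≠] 0) (𝓝 φ))
    (h0 : Tendsto (fun e => P (X e, Y e) / e) (𝓝[≠] 0) (𝓝 φ')) :
    Tendsto (fun e => tm P (C e) i j (X e) (Y e) + tm P (D e) i' j' (X e) (Y e)) (𝓝[≠] 0) (𝓝 0) := by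
  have := (hC.mul (hs.sub h0)).add (hD.mul (hs'.sub h0))
  have e0 : A * (φ - φ') + B * (φ - φ') = 0 := by linear_combination (φ - φ') * hAB
  rw [e0] at this
  refine this.congr' ?_
  filter_upwards [self_mem_nhdsWithin] with e he
  have he : e ≠ 0 := he
  simp only [tm]; field_simp

theorem slope_lim (hP : Differentiable ℂ P) (k k' : ℂ) (hX : ∀ e, X e = x + k * e) (hY : ∀ e, Y e = y + k' * e)
    (h0 : P (x, y) = 0) :
    Tendsto (fun e => P (X e, Y e) / e) (𝓝[≠] 0) (𝓝 (deriv (fun e => P (x + k * e, y + k' * e)) 0)) := by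
  have hd : DifferentiableAt ℂ (fun e : ℂ => P (x + k * e, y + k' * e)) 0 := by fun_prop
  have := hd.hasDerivAt.tendsto_slope_zero
  refine this.congr (fun e => ?_)
  simp [hX, hY, h0, div_eq_inv_mul]
end groups

def AS (m : ℕ) (x : ℂ) : Prop := ∃ n : ℤ, x = n ∧ (|n| ≤ 3 * m ∨ |n| = 3 * m + 2)
def AL (m : ℕ) (w : ℂ) : Prop := ∃ n : ℤ, w = 3 * n ∧ |n| ≤ m

structure gsl (c y : ℂ) : Prop where
  hy : gs y
  hd : gs (c - y)
  ha : gl (c + y)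
  hb : gl (2 * c - y)
  he : gl (2 * y - c)

theorem id_m1a (M y : ℂ) (h1 : y ≠ 0) (h2 : y + 1 ≠ 0) (h3 : y + 2 ≠ 0) (h4 : y - 1 ≠ 0) (h5 : 2 * y + 1 ≠ 0) :
   ((-3*M-3)*(-1-3*M)*(1-3*M)/(-1)/1) * fV M y * fL M (2*y+1) * fL M (-(y+2)) * fK M (y-1) +
    3 * ((-3*M-1)*(3*M+3)*(1-3*M)/3/(-1)) * fS M y * fL M (y+2) * fL M (2*y+1) * fT M (y+1) = 0 := by
  unfold fV fL fK fS fT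
  have h6 : y - 1 + 3 ≠ 0 := by intro h; apply h3; linear_combination h
  have h7 : y + 1 + 1 ≠ 0 := by intro h; apply h3; linear_combination h
  have e6 : y - 1 + 3 = y + 2 := by ring
  have e7 : y + 1 + 1 = y + 2 := by ring
  rw [e6, e7]
  field_simp
  ring

theorem id_m2a (M y : ℂ) (h1 : y ≠ 0) (h2 : y + 1 ≠ 0) (h3 : y + 2 ≠ 0) (h4 : y - 2 ≠ 0) (h5 : y + 4 ≠ 0) :
   ((-3*M-4)*(-2-3*M)*(-3*M)/2/1) * fV M y * fL M (2*y+2) * fL M (-(y+4)) * fK M (y-2) +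
    3 * ((-3*M-4)*(3*M)*(-2-3*M)/6/1) * fS M (y+2) * fL M (2*y+2) * fL M (y-2) * fT M y = 0 := by
  unfold fV fL fK fS fT
  have e6 : y - 2 + 3 = y + 1 := by ring
  have e7 : y + 2 - 1 = y + 1 := by ring
  have e8 : y + 2 + 2 = y + 4 := by ring
  have e9 : 2 * y + 2 = 2 * (y + 1) := by ring
  rw [e6, e7, e8, e9]
  field_simp
  ring

section shortpath
variable (M : ℂ) {c y : ℂ}

theorem tX (c : ℂ) : Tendsto (fun e : ℂ => c + e) (𝓝[≠] 0) (𝓝 c) := by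
  have := te.const_add c; simpa using this
theorem tY (y : ℂ) : Tendsto (fun e : ℂ => y + e / 2) (𝓝[≠] 0) (𝓝 y) := by
  have := (te.div_const 2).const_add y; simpa using this

theorem gsl.mu (h : gsl c y) : gsl c (c - y) :=
  ⟨h.hd, h.hy.of (by ring), h.hb.of (by ring), h.ha.of (by ring), h.he.ofn (by ring)⟩

theorem kb0 (h : gsl c y) (hT : TR c) : Tendsto (fun e => cb M (c+e) (y+e/2)) (𝓝[≠] 0) (𝓝 (cb M c y)) :=
  tb M (tX c) (tY y) hT h.hy.S h.hd.S h.ha.1 h.hb.1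
theorem kb3 (h : gsl c y) (hT : TR (-c)) : Tendsto (fun e => cb M (-(c+e)) (-(y+e/2))) (𝓝[≠] 0) (𝓝 (cb M (-c) (-y))) :=
  tb M (tX c).neg (tY y).neg hT h.hy.neg.S (h.hd.ofn (by ring)).S (h.ha.ofn (by ring)).1 (h.hb.ofn (by ring)).1
theorem kb1 (h : gsl c y) (hT : SR c) :
    Tendsto (fun e => cb M (y+e/2) (y+e/2-(c+e))) (𝓝[≠] 0) (𝓝 (cb M y (y-c))) :=
  tb M (tY y) ((tY y).sub (tX c)) h.hy.T (h.hd.ofn (by ring)).S (by rwa [sub_sub_cancel]) (h.he.of (by ring)).1 (h.ha.of (by ring)).1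
theorem kb2 (h : gsl c y) (hT : SR (-c)) :
    Tendsto (fun e => cb M (y+e/2-(c+e)) (-(c+e))) (𝓝[≠] 0) (𝓝 (cb M (y-c) (-c))) :=
  tb M ((tY y).sub (tX c)) (tX c).neg (h.hd.ofn (by ring)).T hT (h.hy.of (by ring)).S (h.hb.ofn (by ring)).1 (h.he.of (by ring)).1
theorem ka0 (h : gsl c y) (hT : VR c) :
    Tendsto (fun e => ca M (c+e) (y+e/2)) (𝓝[≠] 0) (𝓝 (ca M c y)) :=
  ta M (tX c) (tY y) hT h.hy.V h.ha.K h.he.1 h.hb.1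
theorem ka1 (h : gsl c y) :
    Tendsto (fun e => ca M (y+e/2) (y+e/2-(c+e))) (𝓝[≠] 0) (𝓝 (ca M y (y-c))) :=
  ta M (tY y) ((tY y).sub (tX c)) h.hy.V (h.hd.ofn (by ring)).V (h.he.of (by ring)).K (h.hb.ofn (by ring)).1 (h.ha.of (by ring)).1
theorem ka2 (h : gsl c y) (hT : VR (-c)) :
    Tendsto (fun e => ca M (y+e/2-(c+e)) (-(c+e))) (𝓝[≠] 0) (𝓝 (ca M (y-c) (-c))) :=
  ta M ((tY y).sub (tX c)) (tX c).neg (h.hd.ofn (by ring)).V hT (h.hb.ofn (by ring)).K (h.ha.ofn (by ring)).1 (h.he.of (by ring)).1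

variable {r : ℂ}
theorem pb0 (h : gsl c y) (hT : Tendsto (fun e => e * fT M (c+e)) (𝓝[≠] 0) (𝓝 r)) :
    Tendsto (fun e => e * cb M (c+e) (y+e/2)) (𝓝[≠] 0) (𝓝 (3 * fS M y * fS M (c-y) * fL M (c+y) * fL M (2*c-y) * r)) :=
  tbT M (tX c) (tY y) hT h.hy.S h.hd.S h.ha.1 h.hb.1
theorem pb3 (h : gsl c y) (hT : Tendsto (fun e => e * fT M (-(c+e))) (𝓝[≠] 0) (𝓝 r)) :
    Tendsto (fun e => e * cb M (-(c+e)) (-(y+e/2))) (𝓝[≠] 0)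
      (𝓝 (3 * fS M (-y) * fS M (-c- -y) * fL M (-c+ -y) * fL M (2*(-c)- -y) * r)) :=
  tbT M (tX c).neg (tY y).neg hT h.hy.neg.S (h.hd.ofn (by ring)).S (h.ha.ofn (by ring)).1 (h.hb.ofn (by ring)).1
theorem pb1 (h : gsl c y) (hT : Tendsto (fun e => e * fS M (c+e)) (𝓝[≠] 0) (𝓝 r)) :
    Tendsto (fun e => e * cb M (y+e/2) (y+e/2-(c+e))) (𝓝[≠] 0)
      (𝓝 (3 * fS M (y-c) * r * fL M (y+(y-c)) * fL M (2*y-(y-c)) * fT M y)) :=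
  tbS2 M (tY y) ((tY y).sub (tX c)) (by simpa only [sub_sub_cancel] using hT) h.hy.T (h.hd.ofn (by ring)).S (h.he.of (by ring)).1 (h.ha.of (by ring)).1
theorem pb2 (h : gsl c y) (hT : Tendsto (fun e => e * fS M (-(c+e))) (𝓝[≠] 0) (𝓝 r)) :
    Tendsto (fun e => e * cb M (y+e/2-(c+e)) (-(c+e))) (𝓝[≠] 0)
      (𝓝 (3 * r * fS M (y-c- -c) * fL M (y-c+ -c) * fL M (2*(y-c)- -c) * fT M (y-c))) :=
  tbS1 M ((tY y).sub (tX c)) (tX c).neg hT (h.hd.ofn (by ring)).T (h.hy.of (by ring)).S (h.hb.ofn (by ring)).1 (h.he.of (by ring)).1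
theorem pa0 (h : gsl c y) (hT : Tendsto (fun e => e * fV M (c+e)) (𝓝[≠] 0) (𝓝 r)) :
    Tendsto (fun e => e * ca M (c+e) (y+e/2)) (𝓝[≠] 0)
      (𝓝 (r * fV M y * fL M (2*y-c) * fL M (2*c-y) * fK M (c+y))) :=
  taV1 M (tX c) (tY y) hT h.hy.V h.ha.K h.he.1 h.hb.1
theorem pa2 (h : gsl c y) (hT : Tendsto (fun e => e * fV M (-(c+e))) (𝓝[≠] 0) (𝓝 r)) :
    Tendsto (fun e => e * ca M (y+e/2-(c+e)) (-(c+e))) (𝓝[≠] 0)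
      (𝓝 (fV M (y-c) * r * fL M (2*(-c)-(y-c)) * fL M (2*(y-c)- -c) * fK M (y-c+ -c))) :=
  taV2 M ((tY y).sub (tX c)) (tX c).neg hT (h.hd.ofn (by ring)).V (h.hb.ofn (by ring)).K (h.ha.ofn (by ring)).1 (h.he.of (by ring)).1
end shortpath

noncomputable def halfS (M : ℂ) (P : ℂ × ℂ → ℂ) (x y : ℂ) : ℂ :=
  tm P (cb M y (y-x)) 1 2 x y + tm P (cb M (y-x) (-x)) (-1) 1 x y + tm P (ca M x y) 3 3 x y
  + tm P (ca M y (y-x)) 0 3 x y + tm P (ca M (y-x) (-x)) (-3) 0 x y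

theorem cb_symm (M x y : ℂ) : cb M x (x - y) = cb M x y := by
  unfold cb
  rw [show x - (x - y) = y by ring, show x + (x - y) = 2 * x - y by ring, show 2 * x - (x - y) = x + y by ring]; ring
theorem ca_symm (M x y : ℂ) : ca M y x = ca M x y := by
  unfold ca
  rw [add_comm y x]; ring

theorem opD_halfS (M : ℂ) (P : ℂ × ℂ → ℂ) (x y : ℂ) : opD M P x y =
    tm P (cb M x y) 2 1 x y + tm P (cb M (-x) (-y)) (-2) (-1) x y + halfS M P x y
    + halfS M (fun z => P (z.1, z.1 - z.2)) x (x - y) := by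
  have e1 : cb M (x-y) (x-y-x) = cb M (x-y) x := by rw [← cb_symm]; congr 1; ring
  have e2 : cb M (x-y-x) (-x) = cb M (-y) (x-y) := by rw [← cb_symm]; congr 1 <;> ring
  have e3 : ca M x (x-y) = ca M (x-y) x := ca_symm _ _ _
  have e4 : ca M (x-y) (x-y-x) = ca M (-y) (x-y) := by rw [← ca_symm]; congr 1; ring
  have e5 : ca M (x-y-x) (-x) = ca M (-x) (-y) := by rw [← ca_symm]; congr 1; ring
  simp only [opD, halfS, e1, e2, e3, e4, e5]
  simp only [tm]
  rw [show x + 1 - (x - y + 2) = y + -1 by ring, show x + -1 - (x - y + 1) = y + -2 by ring, show x + 3 - (x - y + 3) = y + 0 by ring,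
    show x + 0 - (x - y + 3) = y + -3 by ring, show x + -3 - (x - y + 0) = y + -3 by ring, show x - (x - y) = y by ring]
  ring

theorem halfS1_0 (M : ℂ) {P : ℂ × ℂ → ℂ} (hP : Continuous P) {y : ℂ} (h : gsl 0 y)
    (q1 : P (-1, y + 1) = P (1, y + 2)) (q3 : P (-3, y) = P (3, y + 3)) :
    Tendsto (fun e => e * halfS M P (0+e) (y+e/2)) (𝓝[≠] 0) (𝓝 0) := by
  have h1 := g1pair (i := 1) (j := 2) (i' := -1) (j' := 1) hP (tX 0) (tY y) (pb1 M h (rS0 M 1 _ (by intro e; ring) (by norm_num)))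
    (pb2 M h (rS0 M (-1) _ (by intro e; ring) (by norm_num))) (by simp; ring_nf) (by right; simpa using q1)
  have h2 := g1pair (i := 3) (j := 3) (i' := -3) (j' := 0) hP (tX 0) (tY y) (pa0 M h (rV0 M 1 _ (by intro e; ring) (by norm_num)))
    (pa2 M h (rV0 M (-1) _ (by intro e; ring) (by norm_num))) (by simp; ring_nf) (by right; simpa using q3)
  have h3 := g1reg (i := 0) (j := 3) hP (tX 0) (tY y) (ka1 M h)
  have := (h1.add h2).add h3
  simp only [add_zero] at this
  exact this.congr (fun e => by simp only [halfS]; ring)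

theorem VR_of {u : ℂ} (h1 : u ≠ 0) (h2 : u ≠ -1) (h3 : u ≠ -2) : VR u := ⟨h1, h2, h3⟩

theorem neg_lem (a b : ℂ) (h : a ≠ b) : a - b ≠ 0 := sub_ne_zero.2 h

theorem res_m1 (M : ℂ) {y : ℂ} (h : gsl (-1) y) :
   (-3*M-3)*(-1-3*M)*(1-3*M)/(-1)/1 * fV M y * fL M (2*y-(-1)) * fL M (2*(-1)-y) * fK M (-1+y) +
   3 * ((-3*M-1)*(3*M+3)*(1-3*M)/3/(-1)) * fS M (y-(-1)- -(-1)) * fL M (y-(-1)+ -(-1)) * fL M (2*(y-(-1))- -(-1)) * fT M (y-(-1)) = 0 := by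
  have h0 := h.hy
  have := id_m1a M y h0.1 (addne h0.2.2.1 (by norm_num)) (addne h0.2.2.2.2 (by norm_num)) (sub_ne_zero.2 h0.2.1)
    (by have := h.he.1; rwa [sub_neg_eq_add] at this)
  rw [show y-(-1)- -(-1) = y by ring, show y-(-1)+ -(-1) = y + 2 by ring, show 2*(y-(-1))- -(-1) = 2*y+1 by ring,
    show y-(-1) = y+1 by ring, show 2*y-(-1) = 2*y+1 by ring, show 2 * (-1) - y = -(y+2) by ring, show -1 + y = y - 1 by ring]
  exact this

theorem res_m2 (M : ℂ) {y : ℂ} (h : gsl (-2) y) :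
   (-3*M-4)*(-2-3*M)*(-3*M)/2/1 * fV M y * fL M (2*y-(-2)) * fL M (2*(-2)-y) * fK M (-2+y) +
   3 * fS M (y-(-2)) * ((-3*M-4)*(3*M)*(-2-3*M)/6/1) * fL M (y+(y-(-2))) * fL M (2*y-(y-(-2))) * fT M y = 0 := by
  have h0 := h.hy
  have := id_m2a M y h0.1 (addne h0.2.2.1 (by norm_num)) (addne h0.2.2.2.2 (by norm_num)) (sub_ne_zero.2 h0.2.2.2.1)
    (by have := h.hb.1; intro h9; apply this; linear_combination -h9)
  rw [show y - (-2) = y + 2 by ring, show y + (y + 2) = 2*y+2 by ring, show 2*y - (y+2) = y - 2 by ring,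
    show 2 * y - (-2) = 2 * y + 2 by ring, show 2 * (-2) - y = -(y+4) by ring, show -2 + y = y - 2 by ring]
  linear_combination this

theorem halfS1_1 (M : ℂ) {P : ℂ × ℂ → ℂ} (hP : Continuous P) {y : ℂ} (h : gsl (-1) y)
    (q1 : P (-2, y + 1) = P (2, y + 3)) :
    Tendsto (fun e => e * halfS M P (-1+e) (y+e/2)) (𝓝[≠] 0) (𝓝 0) := by
  have h1 := g1pair (i := 3) (j := 3) (i' := -1) (j' := 1) hP (tX (-1)) (tY y) (pa0 M h (rVm1 M 1 _ (by intro e; ring) (by norm_num)))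
    (pb2 M h (rS1 M (-1) _ (by intro e; ring) (by norm_num))) (res_m1 M h) (by right; convert q1 using 3 <;> norm_num)
  have h2 := g1reg (i := 1) (j := 2) hP (tX (-1)) (tY y) (kb1 M h ⟨by norm_num, by norm_num, by norm_num⟩)
  have h3 := g1reg (i := 0) (j := 3) hP (tX (-1)) (tY y) (ka1 M h)
  have h4 := g1reg (i := -3) (j := 0) hP (tX (-1)) (tY y) (ka2 M h ⟨by norm_num, by norm_num, by norm_num⟩)
  have := ((h1.add h2).add h3).add h4
  simp only [add_zero] at this
  exact this.congr (fun e => by simp only [halfS]; ring)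

theorem halfS1_2 (M : ℂ) {P : ℂ × ℂ → ℂ} (hP : Continuous P) {y : ℂ} (h : gsl (-2) y)
    (q1 : P (-1, y + 2) = P (1, y + 3)) :
    Tendsto (fun e => e * halfS M P (-2+e) (y+e/2)) (𝓝[≠] 0) (𝓝 0) := by
  have h1 := g1pair (i := 3) (j := 3) (i' := 1) (j' := 2) hP (tX (-2)) (tY y) (pa0 M h (rVm2 M 1 _ (by intro e; ring) (by norm_num)))
    (pb1 M h (rSm2 M 1 _ (by intro e; ring) (by norm_num))) (res_m2 M h) (by right; convert q1 using 3 <;> norm_num)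
  have h2 := g1reg (i := -1) (j := 1) hP (tX (-2)) (tY y) (kb2 M h ⟨by norm_num, by norm_num, by norm_num⟩)
  have h3 := g1reg (i := 0) (j := 3) hP (tX (-2)) (tY y) (ka1 M h)
  have h4 := g1reg (i := -3) (j := 0) hP (tX (-2)) (tY y) (ka2 M h ⟨by norm_num, by norm_num, by norm_num⟩)
  have := ((h1.add h2).add h3).add h4
  simp only [add_zero] at this
  exact this.congr (fun e => by simp only [halfS]; ring)

def QCb (m : ℕ) (P : ℂ × ℂ → ℂ) : Prop := ∀ x y, AS m x → P (x, y) = P (-x, y - x)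
def QCa (m : ℕ) (P : ℂ × ℂ → ℂ) : Prop := ∀ x y, AL m (x + y) → P (x, y) = P (-y, -x)

theorem AS_int (m : ℕ) (n : ℤ) (h : |n| ≤ 3 * m ∨ |n| = 3 * m + 2) (x : ℂ) (hx : x = n) : AS m x := ⟨n, hx, h⟩

theorem cont_mu {P : ℂ × ℂ → ℂ} (hP : Continuous P) : Continuous (fun z : ℂ × ℂ => P (z.1, z.1 - z.2)) := by fun_prop

theorem QCb.mu {m : ℕ} {P : ℂ × ℂ → ℂ} (h : QCb m P) : QCb m (fun z => P (z.1, z.1 - z.2)) := by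
  intro x y hx
  simp only
  rw [h x _ hx]; congr 2; ring

theorem mu_path (c y e : ℂ) : c + e - (y + e/2) = c - y + e/2 := by ring

theorem short1 {m : ℕ} (hm : 1 ≤ m) {P : ℂ × ℂ → ℂ} (hP : Continuous P) (hq : QCb m P) {c y : ℂ}
    (hc : c = 0 ∨ c = -1 ∨ c = -2) (h : gsl c y) :
    Tendsto (fun e => e * opD m P (c+e) (y+e/2)) (𝓝[≠] 0) (𝓝 0) := by
  have hm' : (1:ℤ) ≤ m := by exact_mod_cast hm
  have A1 : AS m 1 := AS_int m 1 (by simp; omega) _ (by simp)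
  have A2 : AS m 2 := AS_int m 2 (by simp; omega) _ (by simp)
  have A3 : AS m 3 := AS_int m 3 (by simp; omega) _ (by simp)
  have key : ∀ Q : ℂ × ℂ → ℂ, Continuous Q → QCb m Q → ∀ y, gsl c y →
      Tendsto (fun e => e * halfS m Q (c+e) (y+e/2)) (𝓝[≠] 0) (𝓝 0) := by
    intro Q hQ hq y h
    rcases hc with rfl | rfl | rfl
    · refine halfS1_0 m hQ h ?_ ?_
      · rw [hq 1 _ A1]; congr 2; ring
      · rw [hq 3 _ A3]; congr 2; ring
    · refine halfS1_1 m hQ h ?_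
      rw [hq 2 _ A2]; congr 2; ring
    · refine halfS1_2 m hQ h ?_
      rw [hq 1 _ A1]; congr 2; ring
  have k1 := key P hP hq y h
  have k2 := key _ (cont_mu hP) hq.mu _ h.mu
  have k3 : Tendsto (fun e => e * (tm P (cb m (c+e) (y+e/2)) 2 1 (c+e) (y+e/2)
      + tm P (cb m (-(c+e)) (-(y+e/2))) (-2) (-1) (c+e) (y+e/2))) (𝓝[≠] 0) (𝓝 0) := by
    rcases hc with rfl | rfl | rfl
    · refine g1pair hP (tX 0) (tY y) (pb0 m h (rT0 _ 1 _ (by intro e; ring) (by norm_num)))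
        (pb3 m h (rT0 _ (-1) _ (by intro e; ring) (by norm_num))) (by simp; ring_nf) (Or.inr ?_)
      rw [zero_add, zero_add, hq 2 _ A2]; congr 2; ring
    · obtain ⟨r, hr⟩ := rTm1 (m:ℂ) 1 (fun e => -1 + e) (by intro e; ring) (by norm_num)
      have h1 := g1single (i := 2) (j := 1) hP (tX (-1)) (tY y) (pb0 m h hr) (by
        rw [show (-1:ℂ)+2=1 by norm_num, hq 1 _ A1]; congr 2; ring)
      have h2 := g1reg (i := -2) (j := -1) hP (tX (-1)) (tY y) (kb3 m h ⟨by norm_num, by norm_num⟩)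
      have := h1.add h2
      simp only [add_zero] at this
      exact this.congr (fun e => by ring)
    · have h1 := g1reg (i := 2) (j := 1) hP (tX (-2)) (tY y) (kb0 m h ⟨by norm_num, by norm_num⟩)
      have h2 := g1reg (i := -2) (j := -1) hP (tX (-2)) (tY y) (kb3 m h ⟨by norm_num, by norm_num⟩)
      have := h1.add h2
      simp only [add_zero] at this
      exact this.congr (fun e => by ring)
  have := (k3.add k1).add k2
  simp only [add_zero] at this
  exact this.congr (fun e => by rw [opD_halfS, mu_path]; ring)

/-! second part -/
def HZb (m : ℕ) (H : ℂ × ℂ → ℂ) : Prop := (∀ x y, AS m x → H (x, y) = 0) ∧ ∀ x y, H (-x, y - x) = - H (x, y)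

theorem HZb.mu {m : ℕ} {P : ℂ × ℂ → ℂ} (h : HZb m P) : HZb m (fun z => P (z.1, z.1 - z.2)) := by
  refine ⟨fun x y hx => h.1 x _ hx, fun x y => ?_⟩
  simp only
  rw [← h.2 x _]; congr 2; ring

theorem deriv_anti {H : ℂ × ℂ → ℂ} (hH : ∀ x y, H (-x, y - x) = - H (x, y)) (a b : ℂ) :
    deriv (fun e => H (-a + 1 * e, b - a + (1/2) * e)) 0 = deriv (fun e => H (a + 1 * e, b + (1/2) * e)) 0 := by
  have : (fun e => H (-a + 1 * e, b - a + (1/2) * e)) = fun e => - (fun e => H (a + 1 * e, b + (1/2) * e)) (-e) := by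
    funext e
    simp only
    rw [← hH]; congr 2 <;> ring
  rw [this, deriv.fun_neg, deriv_comp_neg (fun e => H (a + 1 * e, b + (1/2) * e)) 0]; simp

theorem slopeS {H : ℂ × ℂ → ℂ} (hd : Differentiable ℂ H) (c y i j a b : ℂ) (ha : a = c + i) (hb : b = y + j)
    (h0 : H (a, b) = 0) :
    Tendsto (fun e => H (c + e + i, y + e/2 + j) / e) (𝓝[≠] 0) (𝓝 (deriv (fun e => H (a + 1 * e, b + (1/2) * e)) 0)) :=
  slope_lim hd 1 (1/2) (by intro e; rw [ha]; ring) (by intro e; rw [hb]; ring) h0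

theorem slopeS0 {H : ℂ × ℂ → ℂ} (hd : Differentiable ℂ H) (c y : ℂ) (h0 : H (c, y) = 0) :
    Tendsto (fun e => H (c + e, y + e/2) / e) (𝓝[≠] 0) (𝓝 (deriv (fun e => H (c + 1 * e, y + (1/2) * e)) 0)) :=
  slope_lim hd 1 (1/2) (by intro e; ring) (by intro e; ring) h0

/-- admissible s -/
def adm (m s : ℕ) : Prop := (1 ≤ s ∧ s ≤ 3 * m) ∨ s = 3 * m + 2

theorem adm.inAS {m s : ℕ} (h : adm m s) : AS m (-(s:ℂ)) :=
  ⟨-s, by simp, by unfold adm at h; simp only [abs_neg, Nat.abs_cast]; omega⟩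

theorem AS_shift {m s : ℕ} (i : ℤ) (h : |-(s:ℤ) + i| ≤ 3 * m ∨ |-(s:ℤ) + i| = 3 * m + 2) : AS m (-(s:ℂ) + i) :=
  ⟨-s + i, by push_cast; ring, h⟩

theorem adm.p2 {m s : ℕ} (hm : 1 ≤ m) (h : adm m s) : AS m (-(s:ℂ) + 2) := by
  unfold adm at h; have := AS_shift (m := m) (s := s) 2 (by left; rw [abs_le]; omega); simpa using this
theorem adm.p3 {m s : ℕ} (hm : 1 ≤ m) (h : adm m s) : AS m (-(s:ℂ) + 3) := by
  unfold adm at h; have := AS_shift (m := m) (s := s) 3 (by left; rw [abs_le]; omega); simpa using this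
theorem adm.p1 {m s : ℕ} (h : adm m s) : AS m (-(s:ℂ) + 1) ∨ fS m (-(s:ℂ)) = 0 := by
  unfold adm at h
  rcases h with h | h
  · left; have := AS_shift (m := m) (s := s) 1 (by left; rw [abs_le]; omega); simpa using this
  · right; subst h; unfold fS; push_cast; ring
theorem adm.m1 {m s : ℕ} (h : adm m s) : AS m (-(s:ℂ) + -1) ∨ fS m (s:ℂ) = 0 := by
  unfold adm at h
  by_cases h1 : s = 3 * m
  · right; subst h1; unfold fS; push_cast; ring
  by_cases h1 : s = 3 * m + 2
  · right; subst h1; unfold fS; push_cast; ring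
  left; have := AS_shift (m := m) (s := s) (-1) (by left; rw [abs_le]; omega); simpa using this
theorem adm.m2 {m s : ℕ} (h : adm m s) : AS m (-(s:ℂ) + -2) ∨ fT m (s:ℂ) = 0 := by
  unfold adm at h
  by_cases h1 : s + 1 = 3 * m
  · right
    have : (s:ℂ) + 1 = 3 * m := by exact_mod_cast h1
    unfold fT; rw [this]; simp
  by_cases h1 : s = 3 * m + 2
  · right; subst h1; unfold fT; push_cast; ring
  left; have := AS_shift (m := m) (s := s) (-2) (by
    by_cases s = 3 * m
    · right; rw [abs_of_neg] <;> omega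
    · left; rw [abs_le]; omega)
  simpa using this
theorem adm.m3 {m s : ℕ} (h : adm m s) : AS m (-(s:ℂ) + -3) ∨ fV m (s:ℂ) = 0 := by
  unfold adm at h
  by_cases h1 : s + 2 = 3 * m
  · right
    have : (s:ℂ) + 2 = 3 * m := by exact_mod_cast h1
    unfold fV; rw [this]; simp
  by_cases h1 : s = 3 * m + 2
  · right; subst h1; unfold fV; push_cast; ring
  by_cases h1 : s = 3 * m
  · right; subst h1; unfold fV; push_cast; ring
  left; have := AS_shift (m := m) (s := s) (-3) (by
    by_cases s + 1 = 3 * m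
    · right; rw [abs_of_neg] <;> omega
    · left; rw [abs_le]; omega)
  simpa using this

theorem short2 {m s : ℕ} (hm : 1 ≤ m) (hs : adm m s) {H : ℂ × ℂ → ℂ} (hd : Differentiable ℂ H) (hH : HZb m H) {y : ℂ}
    (h : gsl (-(s:ℂ)) y) :
    Tendsto (fun e => opD m H (-(s:ℂ)+e) (y+e/2)) (𝓝[≠] 0) (𝓝 0) := by
  have hs1 : s = 1 ∨ s = 2 ∨ 3 ≤ s := by unfold adm at hs; omega
  have hs0 : 1 ≤ s := by omega
  -- regularity of s itself
  have TRs : TR (s:ℂ) := ⟨by exact_mod_cast (by omega : s ≠ 0), by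
    intro h; have : (s:ℂ) + 1 = 0 := by rw [h]; ring
    exact absurd this (by exact_mod_cast (by omega : s + 1 ≠ 0))⟩
  have VRs : VR (s:ℂ) := ⟨TRs.1, TRs.2, by
    intro h; have : (s:ℂ) + 2 = 0 := by rw [h]; ring
    exact absurd this (by exact_mod_cast (by omega : s + 2 ≠ 0))⟩
  have ng : ∀ k : ℕ, s ≠ k → -(s:ℂ) ≠ -(k:ℂ) := by
    intro k hk h; apply hk; have := neg_inj.1 h; exact_mod_cast this
  have ps : ∀ k : ℕ, -(s:ℂ) ≠ (k:ℂ) := by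
    intro k h; have : ((s + k : ℕ):ℂ) = 0 := by push_cast; rw [← h]; ring
    have : s + k = 0 := by exact_mod_cast this
    omega
  have key : ∀ Q : ℂ × ℂ → ℂ, Differentiable ℂ Q → HZb m Q → ∀ y, gsl (-(s:ℂ)) y →
      Tendsto (fun e => halfS m Q (-(s:ℂ)+e) (y+e/2)) (𝓝[≠] 0) (𝓝 0) := by
    intro Q hd hQ y h
    have h0 : Q (-(s:ℂ), y) = 0 := hQ.1 _ _ hs.inAS
    have t1 : SR (-(s:ℂ)) → Tendsto (fun e => tm Q (cb m (y+e/2) (y+e/2-(-(s:ℂ)+e))) 1 2 (-(s:ℂ)+e) (y+e/2)) (𝓝[≠] 0) (𝓝 0) := fun hS =>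
      g2reg hd.continuous (tX _) (tY y) (kb1 m h hS) h0 (hs.p1.imp (fun h => hQ.1 _ _ h) (fun h => by
        unfold cb; rw [sub_sub_cancel, h]; ring))
    have t2 : SR (s:ℂ) → Tendsto (fun e => tm Q (cb m (y+e/2-(-(s:ℂ)+e)) (-(-(s:ℂ)+e))) (-1) 1 (-(s:ℂ)+e) (y+e/2)) (𝓝[≠] 0) (𝓝 0) := fun hS =>
      g2reg hd.continuous (tX _) (tY y) (kb2 m h (by rwa [neg_neg])) h0 (hs.m1.imp (fun h => hQ.1 _ _ h) (fun h => by
        unfold cb; rw [neg_neg, h]; ring))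
    have t3 : VR (-(s:ℂ)) → Tendsto (fun e => tm Q (ca m (-(s:ℂ)+e) (y+e/2)) 3 3 (-(s:ℂ)+e) (y+e/2)) (𝓝[≠] 0) (𝓝 0) := fun hS =>
      g2reg hd.continuous (tX _) (tY y) (ka0 m h hS) h0 (Or.inl (hQ.1 _ _ (hs.p3 hm)))
    have t4 : Tendsto (fun e => tm Q (ca m (y+e/2) (y+e/2-(-(s:ℂ)+e))) 0 3 (-(s:ℂ)+e) (y+e/2)) (𝓝[≠] 0) (𝓝 0) :=
      g2reg hd.continuous (tX _) (tY y) (ka1 m h) h0 (Or.inl (hQ.1 _ _ (by rw [add_zero]; exact hs.inAS)))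
    have t5 : Tendsto (fun e => tm Q (ca m (y+e/2-(-(s:ℂ)+e)) (-(-(s:ℂ)+e))) (-3) 0 (-(s:ℂ)+e) (y+e/2)) (𝓝[≠] 0) (𝓝 0) :=
      g2reg hd.continuous (tX _) (tY y) (ka2 m h (by rwa [neg_neg])) h0 (hs.m3.imp (fun h => hQ.1 _ _ h) (fun h => by
        unfold ca; rw [neg_neg, h]; ring))
    have t123 : Tendsto (fun e => tm Q (cb m (y+e/2) (y+e/2-(-(s:ℂ)+e))) 1 2 (-(s:ℂ)+e) (y+e/2) +
        tm Q (cb m (y+e/2-(-(s:ℂ)+e)) (-(-(s:ℂ)+e))) (-1) 1 (-(s:ℂ)+e) (y+e/2) +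
        tm Q (ca m (-(s:ℂ)+e) (y+e/2)) 3 3 (-(s:ℂ)+e) (y+e/2)) (𝓝[≠] 0) (𝓝 0) := by
      rcases hs1 with rfl | rfl | h3
      · have u1 := t1 ⟨by norm_num, by norm_num, by norm_num⟩
        have h' : gsl (-1) y := by simpa using h
        simp only [Nat.cast_one] at *
        have A2 : AS m 2 := by have := hs.p3 hm; norm_num at this; exact this
        have s1 := slopeS hd (-1) y 3 3 2 (y+3) (by norm_num) (by norm_num) (hQ.1 _ _ A2)
        have s2 := slopeS hd (-1) y (-1) 1 (-2) (y+3-2) (by norm_num) (by ring) (by rw [hQ.2, hQ.1 _ _ A2, neg_zero])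
        rw [deriv_anti hQ.2] at s2
        have := g2pair (pa0 m h (rVm1 _ 1 _ (by intro e; ring) (by norm_num)))
          (pb2 m h (rS1 _ (-1) _ (by intro e; ring) (by norm_num))) (res_m1 _ h') s1 s2 (slopeS0 hd _ _ h0)
        have := this.add u1
        rw [add_zero] at this
        exact this.congr (fun e => by ring)
      · have u1 := t2 ⟨by norm_num, by norm_num, by norm_num⟩
        have h' : gsl (-2) y := by simpa using h
        simp only [Nat.cast_ofNat] at *
        have A2 : AS m 1 := by have := hs.p3 hm; norm_num at this; exact this
        have s1 := slopeS hd (-2) y 3 3 1 (y+3) (by norm_num) (by norm_num) (hQ.1 _ _ A2)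
        have s2 := slopeS hd (-2) y 1 2 (-1) (y+3-1) (by norm_num) (by ring) (by rw [hQ.2, hQ.1 _ _ A2, neg_zero])
        rw [deriv_anti hQ.2] at s2
        have := g2pair (pa0 m h (rVm2 _ 1 _ (by intro e; ring) (by norm_num)))
          (pb1 m h (rSm2 _ 1 _ (by intro e; ring) (by norm_num))) (res_m2 _ h') s1 s2 (slopeS0 hd _ _ h0)
        have := this.add u1
        rw [add_zero] at this
        exact this.congr (fun e => by ring)
      · have v1 := ng 1 (by omega)
        have v2 := ng 2 (by omega)
        have v0 := ng 0 (by omega)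
        have w1 := ps 1
        have x1 : (s:ℂ) ≠ 1 := by exact_mod_cast (by omega : s ≠ 1)
        simp only [Nat.cast_one, Nat.cast_ofNat, Nat.cast_zero, neg_zero] at v1 v2 v0 w1
        have := ((t1 ⟨v0, v2, w1⟩).add (t2 ⟨VRs.1, VRs.2.2, x1⟩)).add (t3 ⟨v0, v1, v2⟩)
        simpa only [add_zero] using this
    have := (t123.add t4).add t5
    simp only [add_zero] at this
    exact this
  have h0 : H (-(s:ℂ), y) = 0 := hH.1 _ _ hs.inAS
  have k1 := key H hd hH y h
  have k2 := key _ (by fun_prop) hH.mu _ h.mu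
  have k4 : Tendsto (fun e => tm H (cb m (-(-(s:ℂ)+e)) (-(y+e/2))) (-2) (-1) (-(s:ℂ)+e) (y+e/2)) (𝓝[≠] 0) (𝓝 0) :=
    g2reg hd.continuous (tX _) (tY y) (kb3 m h (by rwa [neg_neg])) h0 (hs.m2.imp (fun h => hH.1 _ _ h) (fun h => by
        unfold cb; rw [neg_neg, h]; ring))
  have k3 : Tendsto (fun e => tm H (cb m (-(s:ℂ)+e) (y+e/2)) 2 1 (-(s:ℂ)+e) (y+e/2)) (𝓝[≠] 0) (𝓝 0) := by
    by_cases h1 : s = 1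
    · subst h1
      simp only [Nat.cast_one] at *
      obtain ⟨r, hr⟩ := rTm1 (m:ℂ) 1 (fun e => -1 + e) (by intro e; ring) (by norm_num)
      have A2 : AS m 1 := by have := hs.p2 hm; norm_num at this; exact this
      have s1 := slopeS hd (-1) y 2 1 1 (y+1) (by norm_num) (by norm_num) (hH.1 _ _ A2)
      have s2 := slopeS0 hd (-1) y h0
      have e1 := deriv_anti hH.2 1 (y+1)
      rw [add_sub_cancel_right] at e1
      rw [e1] at s2
      exact g2single (pb0 m h hr) s1 s2
    · have v1 := ng 1 (by omega)
      have v0 := ng 0 (by omega)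
      simp only [Nat.cast_one, Nat.cast_zero, neg_zero] at v1 v0
      exact g2reg hd.continuous (tX _) (tY y) (kb0 m h ⟨v0, v1⟩) h0 (Or.inl (hH.1 _ _ (hs.p2 hm)))
  have := ((k3.add k4).add k1).add k2
  simp only [add_zero] at this
  exact this.congr (fun e => by rw [opD_halfS, mu_path])

structure gll (x y : ℂ) : Prop where
  hx : gs x
  hy : gs y
  hd : gs (x - y)
  hb : gl (2 * x - y)
  he : gl (2 * y - x)

section longpath
variable (M : ℂ) {x y r : ℂ}

theorem gll.sw (h : gll x y) : gll y x := ⟨h.hy, h.hx, h.hd.ofn (by ring), h.he, h.hb⟩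

theorem lb0 (h : gll x y) (hw : x + y ≠ 0) :
    Tendsto (fun e => cb M (x+e) (y+e)) (𝓝[≠] 0) (𝓝 (cb M x y)) :=
  tb M (tX x) (tX y) h.hx.T h.hy.S h.hd.S hw h.hb.1
theorem lb2 (h : gll x y) :
    Tendsto (fun e => cb M (y+e-(x+e)) (-(x+e))) (𝓝[≠] 0) (𝓝 (cb M (y-x) (-x))) :=
  tb M ((tX y).sub (tX x)) (tX x).neg (h.hd.ofn (by ring)).T h.hx.neg.S (h.hy.of (by ring)).S (h.hb.ofn (by ring)).1 (h.he.of (by ring)).1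
theorem lb4 (h : gll x y) (hw : x + y ≠ 0) :
    Tendsto (fun e => cb M (-(y+e)) (x+e-(y+e))) (𝓝[≠] 0) (𝓝 (cb M (-y) (x-y))) :=
  tb M (tX y).neg ((tX x).sub (tX y)) h.hy.neg.T h.hd.S (h.hx.ofn (by ring)).S (h.he.ofn (by ring)).1
    (by intro h9; apply hw; linear_combination -h9)
theorem la0 (h : gll x y) (hw : KR (x + y)) :
    Tendsto (fun e => ca M (x+e) (y+e)) (𝓝[≠] 0) (𝓝 (ca M x y)) :=
  ta M (tX x) (tX y) h.hx.V h.hy.V hw h.he.1 h.hb.1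
theorem la1 (h : gll x y) (hw : x + y ≠ 0) :
    Tendsto (fun e => ca M (y+e) (y+e-(x+e))) (𝓝[≠] 0) (𝓝 (ca M y (y-x))) :=
  ta M (tX y) ((tX y).sub (tX x)) h.hy.V (h.hd.ofn (by ring)).V (h.he.of (by ring)).K (h.hb.ofn (by ring)).1
    (by intro h9; apply hw; linear_combination h9)
theorem la2 (h : gll x y) (hw : x + y ≠ 0) :
    Tendsto (fun e => ca M (y+e-(x+e)) (-(x+e))) (𝓝[≠] 0) (𝓝 (ca M (y-x) (-x))) :=
  ta M ((tX y).sub (tX x)) (tX x).neg (h.hd.ofn (by ring)).V h.hx.neg.V (h.hb.ofn (by ring)).K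
    (by intro h9; apply hw; linear_combination -h9) (h.he.of (by ring)).1
theorem la3 (h : gll x y) (hw : KR (-x + -y)) :
    Tendsto (fun e => ca M (-(x+e)) (-(y+e))) (𝓝[≠] 0) (𝓝 (ca M (-x) (-y))) :=
  ta M (tX x).neg (tX y).neg h.hx.neg.V h.hy.neg.V hw (h.he.ofn (by ring)).1 (h.hb.ofn (by ring)).1

theorem qb0 (h : gll x y) (hr : Tendsto (fun e => e * fL M (x+e+(y+e))) (𝓝[≠] 0) (𝓝 r)) :
    Tendsto (fun e => e * cb M (x+e) (y+e)) (𝓝[≠] 0) (𝓝 (3 * fS M y * fS M (x-y) * r * fL M (2*x-y) * fT M x)) :=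
  tbL1 M (tX x) (tX y) hr h.hx.T h.hy.S h.hd.S h.hb.1
theorem qb4 (h : gll x y) (hr : Tendsto (fun e => e * fL M (2 * (-(y+e)) - (x+e-(y+e)))) (𝓝[≠] 0) (𝓝 r)) :
    Tendsto (fun e => e * cb M (-(y+e)) (x+e-(y+e))) (𝓝[≠] 0)
      (𝓝 (3 * fS M (x-y) * fS M (-y-(x-y)) * fL M (-y+(x-y)) * r * fT M (-y))) :=
  tbL2 M (tX y).neg ((tX x).sub (tX y)) hr h.hy.neg.T h.hd.S (h.hx.ofn (by ring)).S (h.he.ofn (by ring)).1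
theorem qa1 (h : gll x y) (hr : Tendsto (fun e => e * fL M (2 * (y+e) - (y+e-(x+e)))) (𝓝[≠] 0) (𝓝 r)) :
    Tendsto (fun e => e * ca M (y+e) (y+e-(x+e))) (𝓝[≠] 0)
      (𝓝 (fV M y * fV M (y-x) * fL M (2*(y-x)-y) * r * fK M (y+(y-x)))) :=
  taL2 M (tX y) ((tX y).sub (tX x)) hr h.hy.V (h.hd.ofn (by ring)).V (h.he.of (by ring)).K (h.hb.ofn (by ring)).1
theorem qa2 (h : gll x y) (hr : Tendsto (fun e => e * fL M (2 * (-(x+e)) - (y+e-(x+e)))) (𝓝[≠] 0) (𝓝 r)) :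
    Tendsto (fun e => e * ca M (y+e-(x+e)) (-(x+e))) (𝓝[≠] 0)
      (𝓝 (fV M (y-x) * fV M (-x) * r * fL M (2*(y-x)- -x) * fK M (y-x+ -x))) :=
  taL1 M ((tX y).sub (tX x)) (tX x).neg hr (h.hd.ofn (by ring)).V h.hx.neg.V (h.hb.ofn (by ring)).K (h.he.of (by ring)).1
theorem qa0 (h : gll x y) (hr : Tendsto (fun e => e * fK M (x+e+(y+e))) (𝓝[≠] 0) (𝓝 r)) :
    Tendsto (fun e => e * ca M (x+e) (y+e)) (𝓝[≠] 0) (𝓝 (fV M x * fV M y * fL M (2*y-x) * fL M (2*x-y) * r)) :=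
  taK M (tX x) (tX y) hr h.hx.V h.hy.V h.he.1 h.hb.1
theorem qa3 (h : gll x y) (hr : Tendsto (fun e => e * fK M (-(x+e)+ -(y+e))) (𝓝[≠] 0) (𝓝 r)) :
    Tendsto (fun e => e * ca M (-(x+e)) (-(y+e))) (𝓝[≠] 0)
      (𝓝 (fV M (-x) * fV M (-y) * fL M (2*(-y)- -x) * fL M (2*(-x)- -y) * r)) :=
  taK M (tX x).neg (tX y).neg hr h.hx.neg.V h.hy.neg.V (h.he.ofn (by ring)).1 (h.hb.ofn (by ring)).1
end longpath

noncomputable def halfL (M : ℂ) (P : ℂ × ℂ → ℂ) (x y : ℂ) : ℂ :=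
  tm P (cb M x y) 2 1 x y + tm P (cb M (y-x) (-x)) (-1) 1 x y + tm P (cb M (-y) (x-y)) (-1) (-2) x y
  + tm P (ca M y (y-x)) 0 3 x y + tm P (ca M (y-x) (-x)) (-3) 0 x y

theorem opD_halfL (M : ℂ) (P : ℂ × ℂ → ℂ) (x y : ℂ) : opD M P x y =
    tm P (ca M x y) 3 3 x y + tm P (ca M (-x) (-y)) (-3) (-3) x y + halfL M P x y
    + halfL M (fun z => P (z.2, z.1)) y x := by
  have e1 : cb M y (y-x) = cb M y x := cb_symm _ _ _
  have e2 : cb M (x-y) (-y) = cb M (x-y) x := by rw [← cb_symm]; congr 1; ring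
  have e3 : cb M (-x) (y-x) = cb M (-x) (-y) := by rw [← cb_symm]; congr 1; ring
  have e4 : ca M x (x-y) = ca M (x-y) x := ca_symm _ _ _
  have e5 : ca M (x-y) (-y) = ca M (-y) (x-y) := ca_symm _ _ _
  simp only [opD, halfL, e1, e2, e3, e4, e5]
  simp only [tm]
  ring

theorem halfL1_0 (M : ℂ) {P : ℂ × ℂ → ℂ} (hP : Continuous P) {x : ℂ} (h : gll x (-x))
    (q1 : P (x - 1, -x - 2) = P (x + 2, -x + 1)) (q3 : P (x - 3, -x) = P (x, -x + 3)) :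
    Tendsto (fun e => e * halfL M P (x+e) (-x+e)) (𝓝[≠] 0) (𝓝 0) := by
  have h1 := g1pair (i := 2) (j := 1) (i' := -1) (j' := -2) hP (tX x) (tX (-x)) (qb0 M h (rL0 M 2 _ (by intro e; ring) (by norm_num)))
    (qb4 M h (rL0 M (-2) _ (by intro e; ring) (by norm_num))) (by
      rw [show -(-x) - (x - -x) = -x by ring, show -(-x) + (x - -x) = 2 * x - -x by ring, neg_neg]; ring)
    (by right; simpa only [← sub_eq_add_neg] using q1)
  have h2 := g1pair (i := 0) (j := 3) (i' := -3) (j' := 0) hP (tX x) (tX (-x)) (qa1 M h (rL0 M 2 _ (by intro e; ring) (by norm_num)))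
    (qa2 M h (rL0 M (-2) _ (by intro e; ring) (by norm_num))) (by
      rw [show 2 * (-x - x) - -x = -x + (-x - x) by ring]; ring)
    (by right; simpa only [← sub_eq_add_neg, add_zero] using q3)
  have h3 := g1reg (i := -1) (j := 1) hP (tX x) (tX (-x)) (lb2 M h)
  have := (h1.add h2).add h3
  simp only [add_zero] at this
  exact this.congr (fun e => by simp only [halfL]; ring)

theorem halfL1_3 (M : ℂ) {P : ℂ × ℂ → ℂ} (hP : Continuous P) {x y : ℂ} (hw : x + y ≠ 0) (h : gll x y) :
    Tendsto (fun e => e * halfL M P (x+e) (y+e)) (𝓝[≠] 0) (𝓝 0) := by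
  have h1 := g1reg (i := 2) (j := 1) hP (tX x) (tX y) (lb0 M h hw)
  have h2 := g1reg (i := -1) (j := 1) hP (tX x) (tX y) (lb2 M h)
  have h3 := g1reg (i := -1) (j := -2) hP (tX x) (tX y) (lb4 M h hw)
  have h4 := g1reg (i := 0) (j := 3) hP (tX x) (tX y) (la1 M h hw)
  have h5 := g1reg (i := -3) (j := 0) hP (tX x) (tX y) (la2 M h hw)
  have := (((h1.add h2).add h3).add h4).add h5
  simp only [add_zero] at this
  exact this.congr (fun e => by simp only [halfL]; ring)

theorem QCa.sw {m : ℕ} {P : ℂ × ℂ → ℂ} (h : QCa m P) : QCa m (fun z => P (z.2, z.1)) := by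
  intro x y hx
  simp only
  rw [h y x (by rwa [add_comm])]

theorem AL_int (m : ℕ) (n : ℤ) (h : |n| ≤ m) (x : ℂ) (hx : x = 3 * n) : AL m x := ⟨n, hx, h⟩

theorem long1 {m : ℕ} (hm : 1 ≤ m) {P : ℂ × ℂ → ℂ} (hP : Continuous P) (hq : QCa m P) {x y : ℂ}
    (hc : x + y = 0 ∨ x + y = -3) (h : gll x y) :
    Tendsto (fun e => e * opD m P (x+e) (y+e)) (𝓝[≠] 0) (𝓝 0) := by
  have hm' : (1:ℤ) ≤ m := by exact_mod_cast hm
  have A1 : ∀ w, w = 3 → AL m w := fun w hw => AL_int m 1 (by simp; omega) _ (by simp [hw])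
  have key : ∀ Q : ℂ × ℂ → ℂ, Continuous Q → QCa m Q → ∀ x y, x + y = 0 ∨ x + y = -3 → gll x y →
      Tendsto (fun e => e * halfL m Q (x+e) (y+e)) (𝓝[≠] 0) (𝓝 0) := by
    intro Q hQ hq x y hc h
    rcases hc with hc | hc
    · obtain rfl : y = -x := by linear_combination hc
      refine halfL1_0 m hQ h ?_ ?_
      · rw [hq (x+2) _ (A1 _ (by ring))]; congr 2 <;> ring
      · rw [hq x _ (A1 _ (by ring))]; congr 2 <;> ring
    · exact halfL1_3 m hQ (by rw [hc]; norm_num) h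
  have k1 := key P hP hq x y hc h
  have k2 := key (fun z => P (z.2, z.1)) (by fun_prop) hq.sw y x (by rwa [add_comm]) h.sw
  have k3 : Tendsto (fun e => e * (tm P (ca m (x+e) (y+e)) 3 3 (x+e) (y+e)
      + tm P (ca m (-(x+e)) (-(y+e))) (-3) (-3) (x+e) (y+e))) (𝓝[≠] 0) (𝓝 0) := by
    rcases hc with hc | hc
    · obtain rfl : y = -x := by linear_combination hc
      refine g1pair hP (tX x) (tX (-x)) (qa0 m h (rK0 _ 2 _ (by intro e; ring) (by norm_num)))
        (qa3 m h (rK0 _ (-2) _ (by intro e; ring) (by norm_num))) (by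
          rw [show 2 * -(-x) - -x = 2 * x - -x by ring, neg_neg, show 2 * -x - x = 2 * (-x) - x by ring]; ring) ?_
      by_cases h1 : m = 1
      · left; subst h1; norm_num
      · right
        rw [hq (x+3) _ (AL_int m 2 (by simp; omega) _ (by push_cast; ring))]; congr 2 <;> ring
    · obtain ⟨r, hr⟩ := rKm3 (m:ℂ) 2 (fun e => x + e + (y + e)) (by intro e; linear_combination hc) (by norm_num)
      have h1 := g1single (i := 3) (j := 3) hP (tX x) (tX y) (qa0 m h hr) (by
        rw [hq (x+3) _ (A1 _ (by linear_combination hc))]; congr 2 <;> linear_combination -hc)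
      have h2 := g1reg (i := -3) (j := -3) hP (tX x) (tX y) (la3 m h (by
        rw [← neg_add, hc]; exact ⟨by norm_num, by norm_num⟩))
      have := h1.add h2
      simp only [add_zero] at this
      exact this.congr (fun e => by ring)
  have := (k3.add k1).add k2
  simp only [add_zero] at this
  exact this.congr (fun e => by rw [opD_halfL]; ring)

def HZa (m : ℕ) (H : ℂ × ℂ → ℂ) : Prop := (∀ x y, AL m (x + y) → H (x, y) = 0) ∧ ∀ x y, H (-y, -x) = - H (x, y)

theorem HZa.sw {m : ℕ} {P : ℂ × ℂ → ℂ} (h : HZa m P) : HZa m (fun z => P (z.2, z.1)) :=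
  ⟨fun x y hx => h.1 y x (by rwa [add_comm]), fun x y => h.2 y x⟩

theorem deriv_antiL {H : ℂ × ℂ → ℂ} (hH : ∀ x y, H (-y, -x) = - H (x, y)) (a b a' b' : ℂ) (ha : a' = -b) (hb : b' = -a) :
    deriv (fun e => H (a' + 1 * e, b' + 1 * e)) 0 = deriv (fun e => H (a + 1 * e, b + 1 * e)) 0 := by
  have : (fun e => H (a' + 1 * e, b' + 1 * e)) = fun e => - (fun e => H (a + 1 * e, b + 1 * e)) (-e) := by
    funext e
    simp only
    rw [← hH]; congr 2 <;> simp only [ha, hb] <;> ring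
  rw [this, deriv.fun_neg, deriv_comp_neg (fun e => H (a + 1 * e, b + 1 * e)) 0]; simp

theorem long2 {m s : ℕ} (hs0 : 1 ≤ s) (hsm : s ≤ m) {H : ℂ × ℂ → ℂ} (hd : Differentiable ℂ H) (hH : HZa m H) {x y : ℂ}
    (hw : x + y = -(3 * s)) (h : gll x y) :
    Tendsto (fun e => opD m H (x+e) (y+e)) (𝓝[≠] 0) (𝓝 0) := by
  have hAL : ∀ (k : ℤ) (w : ℂ), |k| ≤ m → w = 3 * k → AL m w := fun k w hk hw => ⟨k, hw, hk⟩
  have b0 : |-(s:ℤ)| ≤ m := by rw [abs_le]; omega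
  have b1 : |-(s:ℤ) + 1| ≤ m := by rw [abs_le]; omega
  have b2 : |-(s:ℤ) + 2| ≤ m := by rw [abs_le]; omega
  have hsne : (s:ℂ) ≠ 0 := by exact_mod_cast (by omega : s ≠ 0)
  have hL : s = m → fL m (3 * s : ℂ) = 0 := by rintro rfl; simp [fL]
  have key : ∀ Q : ℂ × ℂ → ℂ, Differentiable ℂ Q → HZa m Q → ∀ x y : ℂ, x + y = -(3 * s) → gll x y →
      Tendsto (fun e => halfL m Q (x+e) (y+e)) (𝓝[≠] 0) (𝓝 0) := by
    intro Q hd hQ x y hw h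
    have hw0 : x + y ≠ 0 := by rw [hw]; simpa using hsne
    have h0 : Q (x, y) = 0 := hQ.1 _ _ (hAL (-s) _ b0 (by push_cast; linear_combination hw))
    have t1 := g2reg (i := 2) (j := 1) hd.continuous (tX x) (tX y) (lb0 (m:ℂ) h hw0) h0
      (Or.inl (hQ.1 _ _ (hAL (-s+1) _ b1 (by push_cast; linear_combination hw))))
    have t2 := g2reg (i := -1) (j := 1) hd.continuous (tX x) (tX y) (lb2 (m:ℂ) h) h0
      (Or.inl (hQ.1 _ _ (hAL (-s) _ b0 (by push_cast; linear_combination hw))))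
    have t3 := g2reg (i := -1) (j := -2) hd.continuous (tX x) (tX y) (lb4 (m:ℂ) h hw0) h0 (by
      by_cases h1 : s = m
      · right; unfold cb; rw [show 2 * -y - (x - y) = 3 * s by linear_combination -hw, hL h1]; ring
      · left; exact (hQ.1 _ _ (hAL (-s-1) _ (by rw [abs_le]; omega) (by push_cast; linear_combination hw))))
    have t4 := g2reg (i := 0) (j := 3) hd.continuous (tX x) (tX y) (la1 (m:ℂ) h hw0) h0
      (Or.inl (hQ.1 _ _ (hAL (-s+1) _ b1 (by push_cast; linear_combination hw))))
    have t5 := g2reg (i := -3) (j := 0) hd.continuous (tX x) (tX y) (la2 (m:ℂ) h hw0) h0 (by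
      by_cases h1 : s = m
      · right; unfold ca; rw [show 2 * -x - (y - x) = 3 * s by linear_combination -hw, hL h1]; ring
      · left; exact (hQ.1 _ _ (hAL (-s-1) _ (by rw [abs_le]; omega) (by push_cast; linear_combination hw))))
    have := (((t1.add t2).add t3).add t4).add t5
    simp only [add_zero] at this
    exact this
  have hw0 : x + y ≠ 0 := by rw [hw]; simpa using hsne
  have h0 : H (x, y) = 0 := hH.1 _ _ (hAL (-s) _ b0 (by push_cast; linear_combination hw))
  have k1 := key H hd hH x y hw h
  have k2 := key (fun z => H (z.2, z.1)) (by fun_prop) hH.sw y x (by rwa [add_comm]) h.sw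
  have k3 := g2reg (i := -3) (j := -3) hd.continuous (tX x) (tX y) (la3 (m:ℂ) h (by
      rw [show -x + -y = 3 * s by linear_combination -hw]
      refine ⟨by simpa using hsne, ?_⟩
      intro h9
      have : ((s + 1 : ℕ) : ℂ) = 0 := by push_cast; linear_combination h9 / 3
      exact absurd this (by exact_mod_cast (by omega : s + 1 ≠ 0)))) h0 (by
      by_cases h1 : s = m
      · right; unfold ca; rw [show -x + -y = 3 * s by linear_combination -hw, h1]; simp [fK]
      by_cases h2 : s + 1 = m
      · right; unfold ca; rw [show -x + -y = 3 * s by linear_combination -hw, ← h2, show fK ((s+1:ℕ):ℂ) (3 * s) = 0 by unfold fK; push_cast; ring]; ring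
      · left; exact (hH.1 _ _ (hAL (-s-2) _ (by rw [abs_le]; omega) (by push_cast; linear_combination hw))))
  have hp : H (x + 3, y + 3) = 0 := hH.1 _ _ (hAL (-s+2) _ b2 (by push_cast; linear_combination hw))
  have k4 : Tendsto (fun e => tm H (ca m (x+e) (y+e)) 3 3 (x+e) (y+e)) (𝓝[≠] 0) (𝓝 0) := by
    by_cases h1 : s = 1
    · subst h1
      obtain ⟨r, hr⟩ := rKm3 (m:ℂ) 2 (fun e => x + e + (y + e)) (by intro e; push_cast at hw; linear_combination hw) (by norm_num)
      have s1 : Tendsto (fun e => H (x + e + 3, y + e + 3) / e) (𝓝[≠] 0) _ :=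
        slope_lim (x := x + 3) (y := y + 3) hd 1 1 (by intro e; ring) (by intro e; ring) hp
      have s2 : Tendsto (fun e => H (x + e, y + e) / e) (𝓝[≠] 0) _ :=
        slope_lim (x := x) (y := y) hd 1 1 (by intro e; ring) (by intro e; ring) h0
      rw [deriv_antiL hH.2 (x+3) (y+3) x y (by push_cast at hw; linear_combination hw) (by push_cast at hw; linear_combination hw)] at s2
      exact g2single (qa0 m h hr) s1 s2
    · refine g2reg hd.continuous (tX x) (tX y) (la0 m h ⟨hw0, ?_⟩) h0 (Or.inl hp)
      rw [hw]; intro h9; apply h1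
      have : (s:ℂ) = 1 := by linear_combination -h9/3
      exact_mod_cast this
  have := ((k4.add k3).add k1).add k2
  simp only [add_zero] at this
  exact this.congr (fun e => by rw [opD_halfL])

theorem ev_gs (a k : ℂ) (h : k ≠ 0 ∨ gs a) : ∀ᶠ e : ℂ in 𝓝[≠] 0, gs (a + k * e) := by
  have h0 := ev_affine_ne a k 0 (h.imp_right (fun h => h.1))
  have h1 := ev_affine_ne a k 1 (h.imp_right (fun h => h.2.1))
  have h2 := ev_affine_ne a k (-1) (h.imp_right (fun h => h.2.2.1))
  have h3 := ev_affine_ne a k 2 (h.imp_right (fun h => h.2.2.2.1))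
  have h4 := ev_affine_ne a k (-2) (h.imp_right (fun h => h.2.2.2.2))
  filter_upwards [h0, h1, h2, h3, h4] with e h0 h1 h2 h3 h4 using ⟨h0, h1, h2, h3, h4⟩

theorem ev_gl (a k : ℂ) (h : k ≠ 0 ∨ gl a) : ∀ᶠ e : ℂ in 𝓝[≠] 0, gl (a + k * e) := by
  have h0 := ev_affine_ne a k 0 (h.imp_right (fun h => h.1))
  have h1 := ev_affine_ne a k 3 (h.imp_right (fun h => h.2.1))
  have h2 := ev_affine_ne a k (-3) (h.imp_right (fun h => h.2.2))
  filter_upwards [h0, h1, h2] with e h0 h1 h2 using ⟨h0, h1, h2⟩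

structure Reg (x y : ℂ) : Prop where
  hx : gs x
  hy : gs y
  hd : gs (x - y)
  ha : gl (x + y)
  hb : gl (2 * x - y)
  he : gl (2 * y - x)

theorem Reg.R {x y : ℂ} (h : Reg x y) : Reg y (y - x) :=
  ⟨h.hy, h.hd.ofn (by ring), h.hx.of (by ring), h.he.of (by ring), h.ha.of (by ring), h.hb.ofn (by ring)⟩
theorem Reg.sb {x y : ℂ} (h : Reg x y) : Reg (-x) (y - x) :=
  ⟨h.hx.neg, h.hd.ofn (by ring), h.hy.ofn (by ring), h.hb.ofn (by ring), h.ha.ofn (by ring), h.he.of (by ring)⟩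
theorem Reg.sa {x y : ℂ} (h : Reg x y) : Reg (-y) (-x) :=
  ⟨h.hy.neg, h.hx.neg, h.hd.of (by ring), h.ha.ofn (by ring), h.he.ofn (by ring), h.hb.ofn (by ring)⟩

theorem evS {c y : ℂ} (h : gsl c y) : ∀ᶠ e : ℂ in 𝓝[≠] 0, Reg (c + e) (y + e/2) := by
  filter_upwards [ev_gs c 1 (by norm_num), ev_gs y (1/2) (by norm_num), ev_gs (c-y) (1/2) (by norm_num),
    ev_gl (c+y) (3/2) (by norm_num), ev_gl (2*c-y) (3/2) (by norm_num), ev_gl (2*y-c) 0 (Or.inr h.he)] with e h1 h2 h3 h4 h5 h6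
  exact ⟨h1.of (by ring), h2.of (by ring), h3.of (by ring), h4.of (by ring), h5.of (by ring), h6.of (by ring)⟩
theorem evL {x y : ℂ} (h : gll x y) : ∀ᶠ e : ℂ in 𝓝[≠] 0, Reg (x + e) (y + e) := by
  filter_upwards [ev_gs x 1 (by norm_num), ev_gs y 1 (by norm_num), ev_gs (x-y) 0 (Or.inr h.hd),
    ev_gl (x+y) 2 (by norm_num), ev_gl (2*x-y) 1 (by norm_num), ev_gl (2*y-x) 1 (by norm_num)] with e h1 h2 h3 h4 h5 h6
  exact ⟨h1.of (by ring), h2.of (by ring), h3.of (by ring), h4.of (by ring), h5.of (by ring), h6.of (by ring)⟩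

theorem genS {f : ℂ → ℂ} (hf : Continuous f) (c : ℂ) (h : ∀ y, gsl c y → f y = 0) (y : ℂ) : f y = 0 := by
  have ev : ∀ᶠ e : ℂ in 𝓝[≠] 0, f (y + e) = 0 := by
    filter_upwards [ev_gs y 1 (by norm_num), ev_gs (c-y) (-1) (by norm_num),
      ev_gl (c+y) 1 (by norm_num), ev_gl (2*c-y) (-1) (by norm_num), ev_gl (2*y-c) 2 (by norm_num)] with e h1 h2 h3 h4 h5
    exact h _ ⟨h1.of (by ring), h2.of (by ring), h3.of (by ring), h4.of (by ring), h5.of (by ring)⟩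
  have t := (hf.tendsto y).comp (tX y)
  exact tendsto_nhds_unique (t.congr' ev) tendsto_const_nhds

theorem genL {f : ℂ → ℂ} (hf : Continuous f) (w : ℂ) (h : ∀ x, gll x (w - x) → f x = 0) (x : ℂ) : f x = 0 := by
  have ev : ∀ᶠ e : ℂ in 𝓝[≠] 0, f (x + e) = 0 := by
    filter_upwards [ev_gs x 1 (by norm_num), ev_gs (w-x) (-1) (by norm_num), ev_gs (2*x-w) 2 (by norm_num),
      ev_gl (3*x-w) 3 (by norm_num), ev_gl (2*w-3*x) (-3) (by norm_num)] with e h1 h2 h3 h4 h5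
    exact h _ ⟨h1.of (by ring), h2.of (by ring), h3.of (by ring), h4.of (by ring), h5.of (by ring)⟩
  have t := (hf.tendsto x).comp (tX x)
  exact tendsto_nhds_unique (t.congr' ev) tendsto_const_nhds

def rR (z : ℂ × ℂ) : ℂ × ℂ := (z.2, z.2 - z.1)

theorem rR_diff : Differentiable ℂ rR := by unfold rR; fun_prop

theorem AS.neg {m : ℕ} {x : ℂ} (h : AS m x) : AS m (-x) := by
  obtain ⟨n, h1, h2⟩ := h
  exact ⟨-n, by simp [h1], by simpa using h2⟩
theorem AL.neg {m : ℕ} {x : ℂ} (h : AL m x) : AL m (-x) := by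
  obtain ⟨n, h1, h2⟩ := h
  exact ⟨-n, by simp [h1], by simpa using h2⟩

structure QC (m : ℕ) (P : ℂ × ℂ → ℂ) : Prop where
  b0 : QCb m P
  b1 : QCb m (P ∘ rR)
  b2 : QCb m (P ∘ rR ∘ rR)
  a0 : QCa m P
  a1 : QCa m (P ∘ rR)
  a2 : QCa m (P ∘ rR ∘ rR)

theorem QC.R {m : ℕ} {P : ℂ × ℂ → ℂ} (h : QC m P) : QC m (P ∘ rR) := by
  refine ⟨h.b1, h.b2, ?_, h.a1, h.a2, ?_⟩
  · intro x y hx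
    have := h.b0 (-x) (-y) hx.neg
    simp only [Function.comp, rR]
    convert this using 3 <;> ring
  · intro x y hx
    have := h.a0 (-x) (-y) (by rw [← neg_add]; exact hx.neg)
    simp only [Function.comp, rR]
    convert this using 3 <;> ring

theorem opD_R (M : ℂ) (P : ℂ × ℂ → ℂ) (x y : ℂ) : opD M (P ∘ rR) x y = opD M P y (y - x) := by
  simp only [opD, tm, Function.comp, rR]
  rw [show y - x - y = -x by ring, show y - (y - x) = x by ring, show -(y-x) = x - y by ring]
  rw [show y + 1 - (x + 2) = y - x + -1 by ring, show y + 2 - (x + 1) = y - x + 1 by ring, show y + 1 - (x + -1) = y - x + 2 by ring,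
    show y + -1 - (x + -2) = y - x + 1 by ring, show y + -2 - (x + -1) = y - x + -1 by ring, show y + -1 - (x + 1) = y - x + -2 by ring,
    show y + 3 - (x + 3) = y - x + 0 by ring, show y + 3 - (x + 0) = y - x + 3 by ring, show y + 0 - (x + -3) = y - x + 3 by ring,
    show y + -3 - (x + -3) = y - x + 0 by ring, show y + -3 - (x + 0) = y - x + -3 by ring, show y + 0 - (x + 3) = y - x + -3 by ring]
  ring

def sB (z : ℂ × ℂ) : ℂ × ℂ := (-z.1, z.2 - z.1)
def sA (z : ℂ × ℂ) : ℂ × ℂ := (-z.2, -z.1)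
theorem sB_diff : Differentiable ℂ sB := by unfold sB; fun_prop
theorem sA_diff : Differentiable ℂ sA := by unfold sA; fun_prop

theorem opD_sub (M : ℂ) (P Q : ℂ × ℂ → ℂ) (x y : ℂ) : opD M (fun z => P z - Q z) x y = opD M P x y - opD M Q x y := by
  simp only [opD, tm]; ring

theorem opD_sB (M : ℂ) (P : ℂ × ℂ → ℂ) (x y : ℂ) : opD M (P ∘ sB) x y = opD M P (-x) (y - x) := by
  have e0 : cb M (-x) (y - x) = cb M (-x) (-y) := by rw [← cb_symm]; congr 1; ring
  have e1 : cb M (y-x) y = cb M (y-x) (-x) := by rw [← cb_symm]; congr 1; ring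
  have e2 : cb M y x = cb M y (y-x) := by rw [← cb_symm]
  have e3 : cb M x (x-y) = cb M x y := cb_symm _ _ _
  have e4 : cb M (x-y) (-y) = cb M (x-y) x := by rw [← cb_symm]; congr 1; ring
  have e5 : cb M (-y) (-x) = cb M (-y) (x-y) := by rw [← cb_symm]; congr 1; ring
  have f0 : ca M (-x) (y-x) = ca M (y-x) (-x) := ca_symm _ _ _
  have f1 : ca M (y-x) y = ca M y (y-x) := ca_symm _ _ _
  have f2 : ca M y x = ca M x y := ca_symm _ _ _
  have f3 : ca M x (x-y) = ca M (x-y) x := ca_symm _ _ _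
  have f4 : ca M (x-y) (-y) = ca M (-y) (x-y) := ca_symm _ _ _
  have f5 : ca M (-y) (-x) = ca M (-x) (-y) := ca_symm _ _ _
  simp only [opD, tm, Function.comp, sB]
  rw [show y - x - -x = y by ring, show -(y - x) = x - y by ring, show -x - (y - x) = -y by ring, neg_neg]
  rw [e0, e1, e2, e3, e4, e5, f0, f1, f2, f3, f4, f5]
  have g : ∀ i j : ℂ, (-(x + i), y + j - (x + i)) = (-x + -i, y - x + (j - i)) := by intro i j; congr 1 <;> ring
  simp only [g]
  norm_num
  ring

theorem opD_sA (M : ℂ) (P : ℂ × ℂ → ℂ) (x y : ℂ) : opD M (P ∘ sA) x y = opD M P (-y) (-x) := by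
  have e0 : cb M (-y) (-x) = cb M (-y) (x-y) := by rw [← cb_symm]; congr 1; ring
  have e1 : cb M (-x) (y-x) = cb M (-x) (-y) := by rw [← cb_symm]; congr 1; ring
  have e2 : cb M (y-x) y = cb M (y-x) (-x) := by rw [← cb_symm]; congr 1; ring
  have e3 : cb M y x = cb M y (y-x) := by rw [← cb_symm]
  have e4 : cb M x (x-y) = cb M x y := cb_symm _ _ _
  have e5 : cb M (x-y) (-y) = cb M (x-y) x := by rw [← cb_symm]; congr 1; ring
  have f0 : ca M (-x) (y-x) = ca M (y-x) (-x) := ca_symm _ _ _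
  have f1 : ca M (y-x) y = ca M y (y-x) := ca_symm _ _ _
  have f2 : ca M y x = ca M x y := ca_symm _ _ _
  have f3 : ca M x (x-y) = ca M (x-y) x := ca_symm _ _ _
  have f4 : ca M (x-y) (-y) = ca M (-y) (x-y) := ca_symm _ _ _
  have f5 : ca M (-y) (-x) = ca M (-x) (-y) := ca_symm _ _ _
  simp only [opD, tm, Function.comp, sA]
  rw [show -x - -y = y - x by ring, show -y - -x = x - y by ring, neg_neg, neg_neg]
  rw [e0, e1, e2, e3, e4, e5, f0, f1, f2, f3, f4, f5]
  have g : ∀ i j : ℂ, (-(y + j), -(x + i)) = (-y + -j, -x + -i) := by intro i j; congr 1 <;> ring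
  simp only [g]
  norm_num
  ring

structure Sit (m : ℕ) (P F Δ : ℂ × ℂ → ℂ) : Prop where
  hP : Differentiable ℂ P
  hF : Continuous F
  hΔ : Differentiable ℂ Δ
  hq : QC m P
  heq : ∀ x y, Reg x y → F (x, y) = Δ (x, y) * opD m P x y

theorem Sit.R {m : ℕ} {P F Δ : ℂ × ℂ → ℂ} (h : Sit m P F Δ) : Sit m (P ∘ rR) (F ∘ rR) (Δ ∘ rR) :=
  ⟨h.hP.comp rR_diff, h.hF.comp rR_diff.continuous, h.hΔ.comp rR_diff, h.hq.R, fun x y hr => by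
    rw [opD_R]; exact h.heq _ _ hr.R⟩

theorem Sit.vanS {m : ℕ} (hm : 1 ≤ m) {P F Δ : ℂ × ℂ → ℂ} (h : Sit m P F Δ) {c : ℂ} (hc : c = 0 ∨ c = -1 ∨ c = -2)
    (hΔ : ∀ y, Δ (c, y) = 0) (y : ℂ) : F (c, y) = 0 := by
  have hF := h.hF
  refine genS (f := fun y => F (c, y)) (by fun_prop) c (fun y hy => ?_) y
  have t1 := slopeS0 h.hΔ c y (hΔ y)
  have t2 := t1.mul (short1 hm h.hP.continuous h.hq.b0 hc hy)
  rw [mul_zero] at t2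
  have t3 := tP h.hF (tX c) (tY y)
  refine tendsto_nhds_unique (t3.congr' ?_) t2
  filter_upwards [evS hy, self_mem_nhdsWithin] with e he he0
  have he0 : e ≠ 0 := he0
  rw [h.heq _ _ he]; field_simp

theorem Sit.vanL {m : ℕ} (hm : 1 ≤ m) {P F Δ : ℂ × ℂ → ℂ} (h : Sit m P F Δ) {w : ℂ} (hw : w = 0 ∨ w = -3)
    (hΔ : ∀ x, Δ (x, w - x) = 0) (x : ℂ) : F (x, w - x) = 0 := by
  have hF := h.hF
  refine genL (f := fun x => F (x, w - x)) (by fun_prop) w (fun x hx => ?_) x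
  have t1 : Tendsto (fun e => Δ (x + e, w - x + e) / e) (𝓝[≠] 0) _ :=
    slope_lim (x := x) (y := w - x) h.hΔ 1 1 (by intro e; ring) (by intro e; ring) (hΔ x)
  have t2 := t1.mul (long1 hm h.hP.continuous h.hq.a0 (by simpa using hw) hx)
  rw [mul_zero] at t2
  have t3 := tP h.hF (tX x) (tX (w - x))
  refine tendsto_nhds_unique (t3.congr' ?_) t2
  filter_upwards [evL hx, self_mem_nhdsWithin] with e he he0
  have he0 : e ≠ 0 := he0
  rw [h.heq _ _ he]; field_simp

theorem Sit.qb {m : ℕ} (hm : 1 ≤ m) {P q : ℂ × ℂ → ℂ} (h : Sit m P q (fun _ => 1)) : QCb m q := by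
  have hF := h.hF
  have key : ∀ s : ℕ, adm m s → ∀ y, q (-(s:ℂ), y) - q (s, y + s) = 0 := by
    intro s hs y
    refine genS (f := fun y => q (-(s:ℂ), y) - q (s, y + s)) (by fun_prop) (-(s:ℂ)) (fun y hy => ?_) y
    have hH : HZb m (fun z => P z - (P ∘ sB) z) := by
      refine ⟨fun x y hx => ?_, fun x y => ?_⟩
      · simp only [Function.comp, sB]; rw [h.hq.b0 x y hx, sub_self]
      · simp only [Function.comp, sB]; rw [neg_neg, show y - x - -x = y by ring]; ring
    have t2 := short2 hm hs (h.hP.sub (h.hP.comp sB_diff)) hH hy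
    have t3 := (tP h.hF (tX (-(s:ℂ))) (tY y)).sub (tP h.hF (tX (-(s:ℂ))).neg ((tY y).sub (tX (-(s:ℂ)))))
    have t4 := (t3.congr' (f₂ := fun e => opD m (fun z => P z - (P ∘ sB) z) (-(s:ℂ)+e) (y+e/2)) (by
      filter_upwards [evS hy] with e he
      rw [opD_sub, opD_sB, h.heq _ _ he, h.heq _ _ he.sb]; ring))
    have := tendsto_nhds_unique t4 t2
    rw [neg_neg, sub_neg_eq_add] at this
    exact this
  intro x y hx
  obtain ⟨n, rfl, hn⟩ := hx
  rcases lt_trichotomy n 0 with h0 | h0 | h0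
  · obtain ⟨s, rfl⟩ := Int.exists_eq_neg_ofNat h0.le
    have := key s (by unfold adm; simp at hn h0; omega) y
    push_cast
    rw [neg_neg, sub_neg_eq_add]
    linear_combination this
  · subst h0; simp
  · obtain ⟨s, rfl⟩ := Int.eq_ofNat_of_zero_le h0.le
    have := key s (by unfold adm; simp at hn h0; omega) (y - s)
    push_cast
    rw [sub_add_cancel] at this
    linear_combination -this

theorem Sit.qa {m : ℕ} {P q : ℂ × ℂ → ℂ} (h : Sit m P q (fun _ => 1)) : QCa m q := by
  have hF := h.hF
  have key : ∀ s : ℕ, 1 ≤ s → s ≤ m → ∀ x, q (x, -(3*s) - x) - q (-(-(3*s) - x), -x) = 0 := by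
    intro s hs hsm x
    refine genL (f := fun x => q (x, -(3*s) - x) - q (-(-(3*s) - x), -x)) (by fun_prop) (-(3*s)) (fun x hx => ?_) x
    have hH : HZa m (fun z => P z - (P ∘ sA) z) := by
      refine ⟨fun x y hx => ?_, fun x y => ?_⟩
      · simp only [Function.comp, sA]; rw [h.hq.a0 x y hx, sub_self]
      · simp only [Function.comp, sA]; rw [neg_neg, neg_neg]; ring
    have t2 := long2 hs hsm (h.hP.sub (h.hP.comp sA_diff)) hH (by ring) hx
    have t3 := (tP h.hF (tX x) (tX (-(3*s) - x))).sub (tP h.hF (tX (-(3*s) - x)).neg (tX x).neg)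
    have t4 := (t3.congr' (f₂ := fun e => opD m (fun z => P z - (P ∘ sA) z) (x+e) (-(3*s) - x +e)) (by
      filter_upwards [evL hx] with e he
      rw [opD_sub, opD_sA, h.heq _ _ he, h.heq _ _ he.sa]; ring))
    exact tendsto_nhds_unique t4 t2
  intro x y hx
  obtain ⟨n, hxy, hn⟩ := hx
  obtain rfl : y = 3 * n - x := by linear_combination hxy
  rcases lt_trichotomy n 0 with h0 | h0 | h0
  · obtain ⟨s, rfl⟩ := Int.exists_eq_neg_ofNat h0.le
    have := key s (by simp at h0; omega) (by simpa using hn) x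
    push_cast
    rw [mul_neg]
    linear_combination this
  · subst h0; simp
  · obtain ⟨s, rfl⟩ := Int.eq_ofNat_of_zero_le h0.le
    have := key s (by simp at h0; omega) (by simpa using hn) (-(3 * s - x))
    push_cast
    rw [show -(3 * (s:ℂ)) - -(3 * s - x) = -x by ring, neg_neg, neg_neg] at this
    linear_combination -this

theorem Sit.qc {m : ℕ} (hm : 1 ≤ m) {P q : ℂ × ℂ → ℂ} (h : Sit m P q (fun _ => 1)) : QC m q :=
  ⟨h.qb hm, (Sit.R h).qb hm, (Sit.R (Sit.R h)).qb hm, h.qa, (Sit.R h).qa, (Sit.R (Sit.R h)).qa⟩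

noncomputable def sh (u : ℂ) : ℂ := u * (u+2) * (u-1) * (u+1) * (u-2)
noncomputable def lo (w : ℂ) : ℂ := w * (w+3) * (w-3)
noncomputable def nS (M u : ℂ) : ℂ := (u - 3*M - 2) * (u + 3*M + 2) * (u - 3*M) * ((u+1) * (u-2))
noncomputable def nT (M u : ℂ) : ℂ := (u - 3*M - 2) * (u + 1 - 3*M) * ((u+2) * (u-1) * (u-2))
noncomputable def nV (M u : ℂ) : ℂ := (u - 3*M - 2) * (u - 3*M) * (u + 2 - 3*M) * ((u-1) * (u-2))
noncomputable def nL (M w : ℂ) : ℂ := (w - 3*M) * ((w+3) * (w-3))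
noncomputable def nK (M w : ℂ) : ℂ := (w - 3*M) * (w + 3 - 3*M) * (w-3)

theorem nS_eq (M : ℂ) {u : ℂ} (h : gs u) : nS M u = sh u * fS M u := by
  have h0 := h.1
  have h1 : u - 1 ≠ 0 := sub_ne_zero.2 h.2.1
  have h2 : u + 2 ≠ 0 := addne h.2.2.2.2 (by norm_num)
  unfold nS sh fS; field_simp
theorem nT_eq (M : ℂ) {u : ℂ} (h : gs u) : nT M u = sh u * fT M u := by
  have h0 := h.1
  have h2 : u + 1 ≠ 0 := addne h.2.2.1 (by norm_num)
  unfold nT sh fT; field_simp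
theorem nV_eq (M : ℂ) {u : ℂ} (h : gs u) : nV M u = sh u * fV M u := by
  have h0 := h.1
  have h1 : u + 1 ≠ 0 := addne h.2.2.1 (by norm_num)
  have h2 : u + 2 ≠ 0 := addne h.2.2.2.2 (by norm_num)
  unfold nV sh fV; field_simp
theorem nL_eq (M : ℂ) {u : ℂ} (h : gl u) : nL M u = lo u * fL M u := by
  have h0 := h.1
  unfold nL lo fL; field_simp
theorem nK_eq (M : ℂ) {u : ℂ} (h : gl u) : nK M u = lo u * fK M u := by
  have h0 := h.1
  have h1 : u + 3 ≠ 0 := addne h.2.2 (by norm_num)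
  unfold nK lo fK; field_simp

noncomputable def nb (M x y : ℂ) : ℂ :=
  3 * nS M y * nS M (x-y) * nL M (x+y) * nL M (2*x-y) * nT M x * lo (2*y-x)
noncomputable def na (M x y : ℂ) : ℂ :=
  nV M x * nV M y * nL M (2*y-x) * nL M (2*x-y) * nK M (x+y) * sh (x-y)
noncomputable def dl (x y : ℂ) : ℂ := sh x * sh y * sh (x-y) * lo (x+y) * lo (2*y-x) * lo (2*x-y)

theorem nb_eq (M : ℂ) {x y : ℂ} (h : Reg x y) : nb M x y = dl x y * cb M x y := by
  unfold nb dl cb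
  rw [nS_eq M h.hy, nS_eq M h.hd, nL_eq M h.ha, nL_eq M h.hb, nT_eq M h.hx]; ring
theorem na_eq (M : ℂ) {x y : ℂ} (h : Reg x y) : na M x y = dl x y * ca M x y := by
  unfold na dl ca
  rw [nV_eq M h.hx, nV_eq M h.hy, nL_eq M h.he, nL_eq M h.hb, nK_eq M h.ha]; ring

theorem sh_neg (u : ℂ) : sh (-u) = - sh u := by unfold sh; ring
theorem lo_neg (u : ℂ) : lo (-u) = - lo u := by unfold lo; ring

theorem dl_R (x y : ℂ) : dl y (y - x) = dl x y := by
  unfold dl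
  rw [show y - x = -(x-y) by ring, show y - -(x-y) = x by ring, show y + -(x-y) = 2*y-x by ring,
    show 2 * -(x-y) - y = -(2*x-y) by ring, show 2*y - -(x-y) = x+y by ring, sh_neg, lo_neg]
  ring

noncomputable def opN (M : ℂ) (P : ℂ × ℂ → ℂ) (x y : ℂ) : ℂ :=
  tm P (nb M x y) 2 1 x y + tm P (nb M y (y-x)) 1 2 x y + tm P (nb M (y-x) (-x)) (-1) 1 x y
  + tm P (nb M (-x) (-y)) (-2) (-1) x y + tm P (nb M (-y) (x-y)) (-1) (-2) x y + tm P (nb M (x-y) x) 1 (-1) x y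
  + tm P (na M x y) 3 3 x y + tm P (na M y (y-x)) 0 3 x y + tm P (na M (y-x) (-x)) (-3) 0 x y
  + tm P (na M (-x) (-y)) (-3) (-3) x y + tm P (na M (-y) (x-y)) 0 (-3) x y + tm P (na M (x-y) x) 3 0 x y

theorem opN_eq (M : ℂ) (P : ℂ × ℂ → ℂ) {x y : ℂ} (h : Reg x y) : opN M P x y = dl x y * opD M P x y := by
  have r1 := h.R
  have r2 := r1.R
  rw [show y - x - y = -x by ring] at r2
  have r3 := r2.R
  rw [show -x - (y - x) = -y by ring] at r3
  have r4 := r3.R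
  rw [show -y - -x = x - y by ring] at r4
  have r5 := r4.R
  rw [show x - y - -y = x by ring] at r5
  have d1 := dl_R x y
  have d2 := dl_R y (y-x)
  rw [show y - x - y = -x by ring, d1] at d2
  have d3 := dl_R (y-x) (-x)
  rw [show -x - (y - x) = -y by ring, d2] at d3
  have d4 := dl_R (-x) (-y)
  rw [show -y - -x = x - y by ring, d3] at d4
  have d5 := dl_R (-y) (x-y)
  rw [show x - y - -y = x by ring, d4] at d5
  unfold opN opD tm
  rw [nb_eq M h, nb_eq M r1, nb_eq M r2, nb_eq M r3, nb_eq M r4, nb_eq M r5,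
    na_eq M h, na_eq M r1, na_eq M r2, na_eq M r3, na_eq M r4, na_eq M r5, d1, d2, d3, d4, d5]
  ring

theorem nb_an (M : ℂ) {X Y : ℂ × ℂ → ℂ} {z : ℂ × ℂ} (hX : AnalyticAt ℂ X z) (hY : AnalyticAt ℂ Y z) :
    AnalyticAt ℂ (fun z => nb M (X z) (Y z)) z := by
  unfold nb nS nL nT lo; fun_prop
theorem na_an (M : ℂ) {X Y : ℂ × ℂ → ℂ} {z : ℂ × ℂ} (hX : AnalyticAt ℂ X z) (hY : AnalyticAt ℂ Y z) :
    AnalyticAt ℂ (fun z => na M (X z) (Y z)) z := by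
  unfold na nV nL nK sh; fun_prop

theorem tm_an {P N : ℂ × ℂ → ℂ} (hP : ∀ z, AnalyticAt ℂ P z) {z : ℂ × ℂ} (hN : AnalyticAt ℂ N z) (i j : ℂ) :
    AnalyticAt ℂ (fun z => tm P (N z) i j z.1 z.2) z := by
  have h1 : AnalyticAt ℂ (fun z : ℂ × ℂ => z.1) z := analyticAt_fst
  have h2 : AnalyticAt ℂ (fun z : ℂ × ℂ => z.2) z := analyticAt_snd
  have h3 : AnalyticAt ℂ (fun z : ℂ × ℂ => (z.1 + i, z.2 + j)) z :=
    (h1.add analyticAt_const).prod (h2.add analyticAt_const)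
  have h4 : AnalyticAt ℂ (fun z : ℂ × ℂ => P (z.1 + i, z.2 + j)) z :=
    AnalyticAt.fun_comp (g := P) (f := fun z : ℂ × ℂ => (z.1 + i, z.2 + j)) (hP _) h3
  unfold tm
  exact hN.mul (h4.sub (hP z))

theorem opN_an (M : ℂ) {P : ℂ × ℂ → ℂ} (hP : ∀ z, AnalyticAt ℂ P z) (z : ℂ × ℂ) :
    AnalyticAt ℂ (fun z => opN M P z.1 z.2) z := by
  have h1 : AnalyticAt ℂ (fun z : ℂ × ℂ => z.1) z := analyticAt_fst
  have h2 : AnalyticAt ℂ (fun z : ℂ × ℂ => z.2) z := analyticAt_snd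
  unfold opN
  have b : ∀ (X Y : ℂ × ℂ → ℂ) (i j : ℂ), AnalyticAt ℂ X z → AnalyticAt ℂ Y z →
      AnalyticAt ℂ (fun z => tm P (nb M (X z) (Y z)) i j z.1 z.2) z :=
    fun X Y i j hX hY => tm_an (N := fun z => nb M (X z) (Y z)) hP (nb_an M hX hY) i j
  have a : ∀ (X Y : ℂ × ℂ → ℂ) (i j : ℂ), AnalyticAt ℂ X z → AnalyticAt ℂ Y z →
      AnalyticAt ℂ (fun z => tm P (na M (X z) (Y z)) i j z.1 z.2) z :=
    fun X Y i j hX hY => tm_an (N := fun z => na M (X z) (Y z)) hP (na_an M hX hY) i j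
  have hd := h2.sub h1
  have hd' := h1.sub h2
  exact (((((((((((b _ _ 2 1 h1 h2).add (b _ _ 1 2 h2 hd)).add (b _ _ (-1) 1 hd h1.neg)).add
    (b _ _ (-2) (-1) h1.neg h2.neg)).add (b _ _ (-1) (-2) h2.neg hd')).add (b _ _ 1 (-1) hd' h1)).add
    (a _ _ 3 3 h1 h2)).add (a _ _ 0 3 h2 hd)).add (a _ _ (-3) 0 hd h1.neg)).add
    (a _ _ (-3) (-3) h1.neg h2.neg)).add (a _ _ 0 (-3) h2.neg hd')).add (a _ _ 3 0 hd' h1)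

def LL : List (ℤ × ℤ × ℤ) :=
  [(1,0,0),(1,0,1),(1,0,-1),(1,0,2),(1,0,-2),
   (0,1,0),(0,1,1),(0,1,-1),(0,1,2),(0,1,-2),
   (1,-1,0),(1,-1,1),(1,-1,-1),(1,-1,2),(1,-1,-2),
   (1,1,0),(1,1,3),(1,1,-3),(-1,2,0),(-1,2,3),(-1,2,-3),(2,-1,0),(2,-1,3),(2,-1,-3)]

theorem LL_prod (z : ℂ × ℂ) : (LL.map (fun t => lf t z)).prod = dl z.1 z.2 := by
  simp only [LL, List.map, List.prod_cons, List.prod_nil, lf, dl, sh, lo]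
  push_cast
  have e1 : (2:ℂ) * z.2 - z.1 = -1 * z.1 + 2 * z.2 := by ring
  have e2 : (2:ℂ) * z.1 - z.2 = 2 * z.1 + -1 * z.2 := by ring
  have e3 : z.1 - z.2 = 1 * z.1 + -1 * z.2 := by ring
  rw [e1, e2, e3]
  generalize -1 * z.1 + 2 * z.2 = A
  generalize 2 * z.1 + -1 * z.2 = B
  generalize 1 * z.1 + -1 * z.2 = C
  simp only [one_mul, zero_mul, add_zero, zero_add, mul_one]
  generalize z.1 + z.2 = D
  ring

theorem sh_ne {u : ℂ} (h : gs u) : sh u ≠ 0 := by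
  unfold sh
  exact mul_ne_zero (mul_ne_zero (mul_ne_zero (mul_ne_zero h.1 (addne h.2.2.2.2 (by norm_num))) (sub_ne_zero.2 h.2.1))
    (addne h.2.2.1 (by norm_num))) (sub_ne_zero.2 h.2.2.2.1)
theorem lo_ne {u : ℂ} (h : gl u) : lo u ≠ 0 := by
  unfold lo
  exact mul_ne_zero (mul_ne_zero h.1 (addne h.2.2 (by norm_num))) (sub_ne_zero.2 h.2.1)
theorem dl_ne {x y : ℂ} (h : Reg x y) : dl x y ≠ 0 := by
  unfold dl
  exact mul_ne_zero (mul_ne_zero (mul_ne_zero (mul_ne_zero (mul_ne_zero (sh_ne h.hx) (sh_ne h.hy)) (sh_ne h.hd))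
    (lo_ne h.ha)) (lo_ne h.he)) (lo_ne h.hb)

theorem dl_diff : Differentiable ℂ (fun z : ℂ × ℂ => dl z.1 z.2) := by
  unfold dl sh lo; fun_prop

theorem sh_zero {c : ℂ} (hc : c = 0 ∨ c = -1 ∨ c = -2) : sh c = 0 := by
  rcases hc with rfl | rfl | rfl <;> norm_num [sh]
theorem lo_zero {c : ℂ} (hc : c = 0 ∨ c = -3) : lo c = 0 := by
  rcases hc with rfl | rfl <;> norm_num [lo]

/-- package: F∘R^k vanishes -/
theorem van_all {m : ℕ} (hm : 1 ≤ m) {P F : ℂ × ℂ → ℂ} (h : Sit m P F (fun z => dl z.1 z.2)) (x y : ℂ) :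
    ((x = 0 ∨ x = -1 ∨ x = -2) ∨ (x + y = 0 ∨ x + y = -3)) → F (x, y) = 0 := by
  rintro (hc | hw)
  · exact h.vanS hm hc (fun y => by simp [dl, sh_zero hc]) y
  · have := h.vanL hm hw (fun u => by
      simp only [dl]
      rw [show u + (x + y - u) = x + y by ring, lo_zero hw]; ring) x
    rwa [add_sub_cancel_left] at this

theorem Sit.R' {m : ℕ} {P F : ℂ × ℂ → ℂ} (h : Sit m P F (fun z => dl z.1 z.2)) :
    Sit m (P ∘ rR) (F ∘ rR) (fun z => dl z.1 z.2) := by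
  have := h.R
  have e : ((fun z : ℂ × ℂ => dl z.1 z.2) ∘ rR) = (fun z => dl z.1 z.2) := by
    funext z; simp only [Function.comp, rR]; exact dl_R _ _
  rwa [e] at this

theorem van_LL {m : ℕ} (hm : 1 ≤ m) {P F : ℂ × ℂ → ℂ} (h : Sit m P F (fun z => dl z.1 z.2)) :
    ∀ t ∈ LL, ∀ z, lf t z = 0 → F z = 0 := by
  have k0 := van_all hm h
  have k1 : ∀ x y : ℂ, _ → F (x, y) = 0 := fun x y hh => by
    have := van_all hm h.R' (x-y) x hh
    simpa [rR] using this
  have k2 : ∀ x y : ℂ, _ → F (x, y) = 0 := fun x y hh => by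
    have := van_all hm h.R'.R' (-y) (x-y) hh
    simpa [rR] using this
  have k3 : ∀ x y : ℂ, _ → F (x, y) = 0 := fun x y hh => by
    have := van_all hm h.R'.R'.R' (-x) (-y) hh
    simpa [rR] using this
  have k4 : ∀ x y : ℂ, _ → F (x, y) = 0 := fun x y hh => by
    have := van_all hm h.R'.R'.R'.R' (y-x) (-x) hh
    simpa [rR] using this
  have k5 : ∀ x y : ℂ, _ → F (x, y) = 0 := fun x y hh => by
    have := van_all hm h.R'.R'.R'.R'.R' y (y-x) hh
    simpa [rR] using this
  rintro t ht ⟨x, y⟩ hz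
  simp only [lf] at hz
  simp only [LL, List.mem_cons, List.not_mem_nil, or_false] at ht
  rcases ht with rfl | rfl | rfl | rfl | rfl | rfl | rfl | rfl | rfl | rfl | rfl | rfl | rfl | rfl | rfl |
    rfl | rfl | rfl | rfl | rfl | rfl | rfl | rfl | rfl <;> push_cast at hz
  · exact k0 x y (Or.inl (Or.inl (by linear_combination hz)))
  · exact k0 x y (Or.inl (Or.inr (Or.inl (by linear_combination hz))))
  · exact k3 x y (Or.inl (Or.inr (Or.inl (by linear_combination -hz))))
  · exact k0 x y (Or.inl (Or.inr (Or.inr (by linear_combination hz))))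
  · exact k3 x y (Or.inl (Or.inr (Or.inr (by linear_combination -hz))))
  · exact k5 x y (Or.inl (Or.inl (by linear_combination hz)))
  · exact k5 x y (Or.inl (Or.inr (Or.inl (by linear_combination hz))))
  · exact k2 x y (Or.inl (Or.inr (Or.inl (by linear_combination -hz))))
  · exact k5 x y (Or.inl (Or.inr (Or.inr (by linear_combination hz))))
  · exact k2 x y (Or.inl (Or.inr (Or.inr (by linear_combination -hz))))
  · exact k1 x y (Or.inl (Or.inl (by linear_combination hz)))
  · exact k1 x y (Or.inl (Or.inr (Or.inl (by linear_combination hz))))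
  · exact k4 x y (Or.inl (Or.inr (Or.inl (by linear_combination -hz))))
  · exact k1 x y (Or.inl (Or.inr (Or.inr (by linear_combination hz))))
  · exact k4 x y (Or.inl (Or.inr (Or.inr (by linear_combination -hz))))
  · exact k0 x y (Or.inr (Or.inl (by linear_combination hz)))
  · exact k0 x y (Or.inr (Or.inr (by linear_combination hz)))
  · exact k3 x y (Or.inr (Or.inr (by linear_combination -hz)))
  · exact k5 x y (Or.inr (Or.inl (by linear_combination hz)))
  · exact k5 x y (Or.inr (Or.inr (by linear_combination hz)))
  · exact k2 x y (Or.inr (Or.inr (by linear_combination -hz)))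
  · exact k1 x y (Or.inr (Or.inl (by linear_combination hz)))
  · exact k1 x y (Or.inr (Or.inr (by linear_combination hz)))
  · exact k4 x y (Or.inr (Or.inr (by linear_combination -hz)))

theorem main_xy {m : ℕ} (hm : 1 ≤ m) {P : ℂ × ℂ → ℂ} (hP : ∀ z, AnalyticAt ℂ P z) (hq : QC m P) :
    ∃ q : ℂ × ℂ → ℂ, (∀ z, AnalyticAt ℂ q z) ∧ QC m q ∧ ∀ x y, Reg x y → q (x, y) = opD m P x y := by
  have hPd : Differentiable ℂ P := fun z => (hP z).differentiableAt
  have hFa := opN_an (m : ℂ) hP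
  have hs : Sit m P (fun z => opN m P z.1 z.2) (fun z => dl z.1 z.2) :=
    ⟨hPd, continuous_iff_continuousAt.2 fun z => (hFa z).continuousAt, dl_diff, hq, fun x y h => opN_eq _ _ h⟩
  obtain ⟨q, hqa, hqe⟩ := list_div LL _ hFa (by decide) (by decide) (van_LL hm hs)
  have hr : ∀ x y, Reg x y → q (x, y) = opD m P x y := by
    intro x y h
    have := hqe (x, y)
    rw [LL_prod] at this
    simp only at this
    rw [opN_eq _ _ h] at this
    exact (mul_left_cancel₀ (dl_ne h) this).symm
  refine ⟨q, hqa, ?_, hr⟩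
  exact Sit.qc hm ⟨hPd, continuous_iff_continuousAt.2 fun z => (hqa z).continuousAt, by fun_prop, hq,
    fun x y h => by rw [hr x y h, one_mul]⟩

theorem rt3_sq : rt3 * rt3 = 3 := by
  unfold rt3
  rw [← Complex.ofReal_mul, Real.mul_self_sqrt (by norm_num)]; norm_num
theorem rt3_ne : rt3 ≠ 0 := by
  intro h; have := rt3_sq; rw [h] at this; norm_num at this

noncomputable def cx (z : Fin 2 → ℂ) : ℂ := z 0
noncomputable def cy (z : Fin 2 → ℂ) : ℂ := z 0 / 2 + rt3 / 2 * z 1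
noncomputable def Ph (z : Fin 2 → ℂ) : ℂ × ℂ := (cx z, cy z)
noncomputable def Ps (w : ℂ × ℂ) : Fin 2 → ℂ := ![w.1, (2 * w.2 - w.1) * (rt3 / 3)]

theorem Ph_Ps (w : ℂ × ℂ) : Ph (Ps w) = w := by
  have h := rt3_sq
  ext
  · simp [Ph, cx, Ps]
  · simp [Ph, cy, Ps]; linear_combination (2 * w.2 - w.1) / 6 * h
theorem Ps_Ph (z : Fin 2 → ℂ) : Ps (Ph z) = z := by
  have h := rt3_sq
  funext i
  fin_cases i
  · simp [Ph, cx, Ps]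
  · simp [Ph, cy, cx, Ps]; linear_combination z 1 / 3 * h

theorem bz1 (z : Fin 2 → ℂ) : bil vβ₁ z = cx z := by simp [bil, vβ₁, cx]
theorem bz2 (z : Fin 2 → ℂ) : bil vβ₂ z = cy z := by simp [bil, vβ₂, cy]; ring
theorem bz3 (z : Fin 2 → ℂ) : bil vβ₃ z = cy z - cx z := by simp [bil, vβ₃, cx, cy]; ring
theorem az1 (z : Fin 2 → ℂ) : bil vα₁ z = 2 * cy z - cx z := by simp [bil, vα₁, cx, cy]; ring
theorem az2 (z : Fin 2 → ℂ) : bil vα₂ z = cy z - 2 * cx z := by simp [bil, vα₂, cx, cy]; ring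
theorem az3 (z : Fin 2 → ℂ) : bil vα₃ z = cx z + cy z := by simp [bil, vα₃, cx, cy]; ring
theorem bil_neg_l (u z : Fin 2 → ℂ) : bil (-u) z = - bil u z := by simp [bil]; ring
theorem bil_smul_l (c : ℂ) (u z : Fin 2 → ℂ) : bil (c • u) z = c * bil u z := by simp [bil]; ring
theorem cx_add (u v : Fin 2 → ℂ) : cx (u + v) = cx u + cx v := by simp [cx]
theorem cy_add (u v : Fin 2 → ℂ) : cy (u + v) = cy u + cy v := by simp [cy]; ring
theorem cx_sub (u v : Fin 2 → ℂ) : cx (u - v) = cx u - cx v := by simp [cx]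
theorem cy_sub (u v : Fin 2 → ℂ) : cy (u - v) = cy u - cy v := by simp [cy]; ring
theorem cx_smul (c : ℂ) (v : Fin 2 → ℂ) : cx (c • v) = c * cx v := by simp [cx]
theorem cy_smul (c : ℂ) (v : Fin 2 → ℂ) : cy (c • v) = c * cy v := by simp [cy]; ring
theorem cx_neg (v : Fin 2 → ℂ) : cx (-v) = - cx v := by simp [cx]
theorem cy_neg (v : Fin 2 → ℂ) : cy (-v) = - cy v := by simp [cy]; ring
theorem xb1 : cx vβ₁ = 1 := by simp [cx, vβ₁]
theorem xb2 : cx vβ₂ = 1/2 := by simp [cx, vβ₂]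
theorem xb3 : cx vβ₃ = -(1/2) := by simp [cx, vβ₃]
theorem xa1 : cx vα₁ = 0 := by simp [cx, vα₁]
theorem xa2 : cx vα₂ = -(3/2) := by simp [cx, vα₂]
theorem xa3 : cx vα₃ = 3/2 := by simp [cx, vα₃]
theorem yb1 : cy vβ₁ = 1/2 := by simp [cy, vβ₁]
theorem yb2 : cy vβ₂ = 1 := by simp [cy, vβ₂]; linear_combination rt3_sq/4
theorem yb3 : cy vβ₃ = 1/2 := by simp [cy, vβ₃]; linear_combination rt3_sq/4
theorem ya1 : cy vα₁ = 3/2 := by simp [cy, vα₁]; linear_combination rt3_sq/2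
theorem ya2 : cy vα₂ = 0 := by simp [cy, vα₂]; linear_combination rt3_sq/4
theorem ya3 : cy vα₃ = 3/2 := by simp [cy, vα₃]; linear_combination rt3_sq/4

theorem D1Reg.reg {z : Fin 2 → ℂ} (h : D1Reg z) : Reg (cx z) (cy z) := by
  have b1 := h vβ₁ (by simp [G2plus])
  have b2 := h vβ₂ (by simp [G2plus])
  have b3 := h vβ₃ (by simp [G2plus])
  have a1 := h vα₁ (by simp [G2plus])
  have a2 := h vα₂ (by simp [G2plus])
  have a3 := h vα₃ (by simp [G2plus])
  simp only [bz1, bz2, bz3, az1, az2, az3, xb1, xb2, xb3, xa1, xa2, xa3, yb1, yb2, yb3, ya1, ya2, ya3] at b1 b2 b3 a1 a2 a3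
  norm_num at b1 b2 b3 a1 a2 a3
  have B3 : gs (cy z - cx z) := b3
  have A2 : gl (cy z - 2 * cx z) := ⟨a2.1, a2.2.1, a2.2.2.1⟩
  exact ⟨b1, b2, B3.ofn (by ring), ⟨a3.1, a3.2.1, a3.2.2.1⟩, A2.ofn (by ring), ⟨a1.1, a1.2.1, a1.2.2.1⟩⟩

theorem cS_eq (M : ℂ) {u : ℂ} (h : gs u) :
    (1 - (3 * M + 2) * 1 / u) * (1 + 3 * M * 1 / (u + 2 * 1)) * (1 - (3 * M - 1) * 1 / (u - 1)) = fS M u := by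
  have h0 := h.1
  have h1 : u - 1 ≠ 0 := sub_ne_zero.2 h.2.1
  have h2 : u + 2 ≠ 0 := addne h.2.2.2.2 (by norm_num)
  unfold fS; rw [mul_one 2]; field_simp; ring
theorem cT_eq (M : ℂ) {u : ℂ} (h : gs u) :
    (1 - (3 * M + 2) * 1 / u) * (1 - 3 * M * 1 / (u + 1)) = fT M u := by
  have h0 := h.1
  have h2 : u + 1 ≠ 0 := addne h.2.2.1 (by norm_num)
  unfold fT; field_simp; ring
theorem cV_eq (M : ℂ) {u : ℂ} (h : gs u) :
    (1 - (3 * M + 2) * 1 / u) * (1 - (3 * M + 1) * 1 / (u + 1)) * (1 - 3 * M * 1 / (u + 2 * 1)) = fV M u := by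
  have h0 := h.1
  have h1 : u + 1 ≠ 0 := addne h.2.2.1 (by norm_num)
  have h2 : u + 2 ≠ 0 := addne h.2.2.2.2 (by norm_num)
  unfold fV; rw [mul_one 2]; field_simp; ring
theorem cL_eq (M : ℂ) {u : ℂ} (h : gl u) : 1 - M * 3 / u = fL M u := by
  have h0 := h.1
  unfold fL; field_simp
theorem cK_eq (M : ℂ) {u : ℂ} (h : gl u) : (1 - M * 3 / u) * (1 - M * 3 / (u + 3)) = fK M u := by
  have h0 := h.1
  have h1 : u + 3 ≠ 0 := addne h.2.2 (by norm_num)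
  unfold fK; field_simp

theorem two_smul_inv (g : Fin 2 → ℂ) : (2⁻¹ : ℂ) • (2 : ℂ) • g = g := by
  rw [smul_smul]; norm_num

theorem notShort {g : Fin 2 → ℂ} (h : bil g g = 3) : (2:ℂ) • g ∉ twoShort := by
  intro hh
  simp only [twoShort, List.mem_map] at hh
  obtain ⟨v, hv, he⟩ := hh
  have : v = g := by
    have := congrArg (fun w => (2⁻¹ : ℂ) • w) he
    simpa only [two_smul_inv] using this
  subst this
  have h1 : bil v v = 1 := by
    simp only [shortRoots, List.mem_cons, List.not_mem_nil, or_false] at hv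
    rcases hv with rfl | rfl | rfl | rfl | rfl | rfl <;>
    simp only [bil_neg_l, bz1, bz2, bz3, cx_neg, cy_neg, xb1, xb2, xb3, yb1, yb2, yb3] <;> norm_num
  rw [h1] at h; norm_num at h


theorem aD1_short (m : ℕ) {z g s1 s2 l1 l2 : Fin 2 → ℂ} (X Y : ℂ) (hg : g ∈ shortRoots)
    (hS : ∀ f : (Fin 2 → ℂ) → Bool, (∀ γ, f γ = true ↔ bil ((2:ℂ) • g) γ = bil γ γ) → shortRoots.filter f = [s1, s2])
    (hL : ∀ f : (Fin 2 → ℂ) → Bool, (∀ γ, f γ = true ↔ bil ((2:ℂ) • g) γ = bil γ γ) → longRoots.filter f = [l1, l2])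
    (hn : bil g g = 1 ∧ bil s1 s1 = 1 ∧ bil s2 s2 = 1 ∧ bil l1 l1 = 3 ∧ bil l2 l2 = 3)
    (hr : Reg X Y) (hX : bil g z = X)
    (hs : (bil s1 z = Y ∧ bil s2 z = X - Y) ∨ (bil s1 z = X - Y ∧ bil s2 z = Y))
    (hl : (bil l1 z = X + Y ∧ bil l2 z = 2 * X - Y) ∨ (bil l1 z = 2 * X - Y ∧ bil l2 z = X + Y)) :
    aD1 m ((2:ℂ) • g) z = cb m X Y := by
  have hm : (2:ℂ) • g ∈ twoShort := List.mem_map_of_mem hg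
  obtain ⟨n0, n1, n2, n3, n4⟩ := hn
  simp only [aD1, if_pos hm, two_smul_inv]
  rw [hS _ (fun γ => by simp), hL _ (fun γ => by simp)]
  simp only [List.map, List.prod_cons, List.prod_nil, n0, n1, n2, n3, n4, hX]
  rw [cT_eq _ hr.hx]
  unfold cb
  rcases hs with ⟨h1, h2⟩ | ⟨h1, h2⟩ <;> rcases hl with ⟨h3, h4⟩ | ⟨h3, h4⟩ <;>
  rw [h1, h2, h3, h4, cS_eq _ hr.hy, cS_eq _ hr.hd, cL_eq _ hr.ha, cL_eq _ hr.hb] <;> ring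

theorem aD1_long (m : ℕ) {z g s1 s2 l1 l2 : Fin 2 → ℂ} (X Y : ℂ)
    (hS : ∀ f : (Fin 2 → ℂ) → Bool, (∀ γ, f γ = true ↔ bil ((2:ℂ) • g) γ = 3 * bil γ γ) → shortRoots.filter f = [s1, s2])
    (hL : ∀ f : (Fin 2 → ℂ) → Bool, (∀ γ, f γ = true ↔ bil ((2:ℂ) • g) γ = bil γ γ) → longRoots.filter f = [l1, l2])
    (hn : bil g g = 3 ∧ bil s1 s1 = 1 ∧ bil s2 s2 = 1 ∧ bil l1 l1 = 3 ∧ bil l2 l2 = 3)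
    (hr : Reg X Y) (hX : bil g z = X + Y)
    (hs : (bil s1 z = Y ∧ bil s2 z = X) ∨ (bil s1 z = X ∧ bil s2 z = Y))
    (hl : (bil l1 z = 2 * Y - X ∧ bil l2 z = 2 * X - Y) ∨ (bil l1 z = 2 * X - Y ∧ bil l2 z = 2 * Y - X)) :
    aD1 m ((2:ℂ) • g) z = ca m X Y := by
  obtain ⟨n0, n1, n2, n3, n4⟩ := hn
  have hm := notShort n0
  simp only [aD1, if_neg hm, two_smul_inv]
  rw [hS _ (fun γ => by simp), hL _ (fun γ => by simp)]
  simp only [List.map, List.prod_cons, List.prod_nil, n0, n1, n2, n3, n4, hX]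
  rw [cK_eq _ hr.ha]
  unfold ca
  rcases hs with ⟨h1, h2⟩ | ⟨h1, h2⟩ <;> rcases hl with ⟨h3, h4⟩ | ⟨h3, h4⟩ <;>
  rw [h1, h2, h3, h4, cV_eq _ hr.hy, cV_eq _ hr.hx, cL_eq _ hr.he, cL_eq _ hr.hb] <;> ring


set_option maxHeartbeats 2000000 in
theorem aD1_short_all (m : ℕ) {z : Fin 2 → ℂ} (h : Reg (cx z) (cy z)) :
    aD1 m ((2:ℂ) • vβ₁) z = cb m (cx z) (cy z) ∧
    aD1 m ((2:ℂ) • vβ₂) z = cb m (cy z) (cy z - cx z) ∧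
    aD1 m ((2:ℂ) • vβ₃) z = cb m (cy z - cx z) (-cx z) ∧
    aD1 m ((2:ℂ) • (-vβ₁)) z = cb m (-cx z) (-cy z) ∧
    aD1 m ((2:ℂ) • (-vβ₂)) z = cb m (-cy z) (cx z - cy z) ∧
    aD1 m ((2:ℂ) • (-vβ₃)) z = cb m (cx z - cy z) (cx z) := by
  have r1 := h.R
  have r2 := r1.R
  rw [show cy z - cx z - cy z = -cx z by ring] at r2
  have r3 := r2.R
  rw [show -cx z - (cy z - cx z) = -cy z by ring] at r3
  have r4 := r3.R
  rw [show -cy z - -cx z = cx z - cy z by ring] at r4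
  have r5 := r4.R
  rw [show cx z - cy z - -cy z = cx z by ring] at r5
  refine ⟨aD1_short m (s1 := vβ₂) (s2 := (-vβ₃)) (l1 := vα₃) (l2 := (-vα₂)) _ _ ?_ ?_ ?_ ?_ h ?_ ?_ ?_,
    aD1_short m (s1 := vβ₁) (s2 := vβ₃) (l1 := vα₁) (l2 := vα₃) _ _ ?_ ?_ ?_ ?_ r1 ?_ ?_ ?_,
    aD1_short m (s1 := vβ₂) (s2 := (-vβ₁)) (l1 := vα₁) (l2 := vα₂) _ _ ?_ ?_ ?_ ?_ r2 ?_ ?_ ?_,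
    aD1_short m (s1 := vβ₃) (s2 := (-vβ₂)) (l1 := vα₂) (l2 := (-vα₃)) _ _ ?_ ?_ ?_ ?_ r3 ?_ ?_ ?_,
    aD1_short m (s1 := (-vβ₁)) (s2 := (-vβ₃)) (l1 := (-vα₁)) (l2 := (-vα₃)) _ _ ?_ ?_ ?_ ?_ r4 ?_ ?_ ?_,
    aD1_short m (s1 := vβ₁) (s2 := (-vβ₂)) (l1 := (-vα₁)) (l2 := (-vα₂)) _ _ ?_ ?_ ?_ ?_ r5 ?_ ?_ ?_⟩
  all_goals first
    | (simp only [shortRoots, List.mem_cons, List.not_mem_nil, true_or, or_true, or_false]; done)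
    | (intro f hf
       simp only [shortRoots, longRoots, List.filter_cons, List.filter_nil, hf, bil_smul_l, bil_neg_l, bz1, bz2, bz3, az1, az2, az3, cx_neg, cy_neg, xb1, xb2, xb3, xa1, xa2, xa3, yb1, yb2, yb3, ya1, ya2, ya3]
       norm_num; done)
    | (refine ⟨?_, ?_, ?_, ?_, ?_⟩ <;> simp only [bil_smul_l, bil_neg_l, bz1, bz2, bz3, az1, az2, az3, cx_neg, cy_neg, xb1, xb2, xb3, xa1, xa2, xa3, yb1, yb2, yb3, ya1, ya2, ya3] <;> norm_num; done)
    | (simp only [bil_neg_l, bz1, bz2, bz3, az1, az2, az3] <;> ring1; done)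
    | (left; constructor <;> (simp only [bil_neg_l, bz1, bz2, bz3, az1, az2, az3] <;> ring1); done)
    | (right; constructor <;> (simp only [bil_neg_l, bz1, bz2, bz3, az1, az2, az3] <;> ring1); done)

set_option maxHeartbeats 2000000 in
theorem aD1_long_all (m : ℕ) {z : Fin 2 → ℂ} (h : Reg (cx z) (cy z)) :
    aD1 m ((2:ℂ) • vα₃) z = ca m (cx z) (cy z) ∧
    aD1 m ((2:ℂ) • vα₁) z = ca m (cy z) (cy z - cx z) ∧
    aD1 m ((2:ℂ) • vα₂) z = ca m (cy z - cx z) (-cx z) ∧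
    aD1 m ((2:ℂ) • (-vα₃)) z = ca m (-cx z) (-cy z) ∧
    aD1 m ((2:ℂ) • (-vα₁)) z = ca m (-cy z) (cx z - cy z) ∧
    aD1 m ((2:ℂ) • (-vα₂)) z = ca m (cx z - cy z) (cx z) := by
  have r1 := h.R
  have r2 := r1.R
  rw [show cy z - cx z - cy z = -cx z by ring] at r2
  have r3 := r2.R
  rw [show -cx z - (cy z - cx z) = -cy z by ring] at r3
  have r4 := r3.R
  rw [show -cy z - -cx z = cx z - cy z by ring] at r4
  have r5 := r4.R
  rw [show cx z - cy z - -cy z = cx z by ring] at r5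
  refine ⟨aD1_long m (s1 := vβ₁) (s2 := vβ₂) (l1 := vα₁) (l2 := (-vα₂)) _ _ ?_ ?_ ?_ h ?_ ?_ ?_,
    aD1_long m (s1 := vβ₂) (s2 := vβ₃) (l1 := vα₂) (l2 := vα₃) _ _ ?_ ?_ ?_ r1 ?_ ?_ ?_,
    aD1_long m (s1 := vβ₃) (s2 := (-vβ₁)) (l1 := vα₁) (l2 := (-vα₃)) _ _ ?_ ?_ ?_ r2 ?_ ?_ ?_,
    aD1_long m (s1 := (-vβ₁)) (s2 := (-vβ₂)) (l1 := vα₂) (l2 := (-vα₁)) _ _ ?_ ?_ ?_ r3 ?_ ?_ ?_,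
    aD1_long m (s1 := (-vβ₂)) (s2 := (-vβ₃)) (l1 := (-vα₂)) (l2 := (-vα₃)) _ _ ?_ ?_ ?_ r4 ?_ ?_ ?_,
    aD1_long m (s1 := vβ₁) (s2 := (-vβ₃)) (l1 := vα₃) (l2 := (-vα₁)) _ _ ?_ ?_ ?_ r5 ?_ ?_ ?_⟩
  all_goals first
    | (simp only [shortRoots, List.mem_cons, List.not_mem_nil, true_or, or_true, or_false]; done)
    | (intro f hf
       simp only [shortRoots, longRoots, List.filter_cons, List.filter_nil, hf, bil_smul_l, bil_neg_l, bz1, bz2, bz3, az1, az2, az3, cx_neg, cy_neg, xb1, xb2, xb3, xa1, xa2, xa3, yb1, yb2, yb3, ya1, ya2, ya3]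
       norm_num; done)
    | (refine ⟨?_, ?_, ?_, ?_, ?_⟩ <;> simp only [bil_smul_l, bil_neg_l, bz1, bz2, bz3, az1, az2, az3, cx_neg, cy_neg, xb1, xb2, xb3, xa1, xa2, xa3, yb1, yb2, yb3, ya1, ya2, ya3] <;> norm_num; done)
    | (simp only [bil_neg_l, bz1, bz2, bz3, az1, az2, az3] <;> ring1; done)
    | (left; constructor <;> (simp only [bil_neg_l, bz1, bz2, bz3, az1, az2, az3] <;> ring1); done)
    | (right; constructor <;> (simp only [bil_neg_l, bz1, bz2, bz3, az1, az2, az3] <;> ring1); done)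

theorem Ph_add2 (z g : Fin 2 → ℂ) : Ph (z + (2:ℂ) • g) = (cx z + 2 * cx g, cy z + 2 * cy g) := by
  simp [Ph, cx_add, cy_add, cx_smul, cy_smul]

theorem applyD1_eq (m : ℕ) (P : ℂ × ℂ → ℂ) {z : Fin 2 → ℂ} (h : Reg (cx z) (cy z)) :
    applyD1 m (fun z => P (Ph z)) z = opD m P (cx z) (cy z) := by
  obtain ⟨b1, b2, b3, b4, b5, b6⟩ := aD1_short_all m h
  obtain ⟨a1, a2, a3, a4, a5, a6⟩ := aD1_long_all m h
  simp only [applyD1, twoG2, G2all, longRoots, shortRoots, List.map, List.cons_append, List.nil_append,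
    List.sum_cons, List.sum_nil, a1, a2, a3, a4, a5, a6, b1, b2, b3, b4, b5, b6, Ph_add2]
  simp only [cx_neg, cy_neg, xb1, xb2, xb3, xa1, xa2, xa3, yb1, yb2, yb3, ya1, ya2, ya3]
  norm_num
  simp only [opD, tm, Ph]
  norm_num
  ring

theorem refl_short {m : ℕ} {p : (Fin 2 → ℂ) → ℂ} (hp : QuasiInvAG2 m p) {β : Fin 2 → ℂ}
    (hβ : β ∈ [vβ₁, vβ₂, vβ₃]) (hb : bil β β = 1) {z : Fin 2 → ℂ} (hz : AS m (bil β z)) :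
    p z = p (z - (2 * bil β z) • β) := by
  obtain ⟨n, hn, hn2⟩ := hz
  have hadd : ∀ c : ℂ, bil β (z + c • β) = bil β z + c * bil β β := by intro c; simp [bil]; ring
  have h0 : bil β (z + (-(n:ℂ)) • β) = 0 := by rw [hadd, hb, hn]; ring
  rcases lt_trichotomy n 0 with h1 | h1 | h1
  · obtain ⟨s, rfl⟩ := Int.exists_eq_neg_ofNat h1.le
    have := hp.2 β hβ s (by simp at hn2 h1; omega) _ h0
    rw [hn]
    push_cast at this ⊢
    convert this.symm using 2 <;> module
  · subst h1; rw [hn]; simp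
  · obtain ⟨s, rfl⟩ := Int.eq_ofNat_of_zero_le h1.le
    have := hp.2 β hβ s (by simp at hn2 h1; omega) _ h0
    rw [hn]
    push_cast at this ⊢
    convert this using 2 <;> module

theorem refl_long {m : ℕ} {p : (Fin 2 → ℂ) → ℂ} (hp : QuasiInvAG2 m p) {α : Fin 2 → ℂ}
    (hα : α ∈ [vα₁, vα₂, vα₃]) (hb : bil α α = 3) {z : Fin 2 → ℂ} (hz : AL m (bil α z)) :
    p z = p (z - (2 / 3 * bil α z) • α) := by
  obtain ⟨n, hn, hn2⟩ := hz
  have hadd : ∀ c : ℂ, bil α (z + c • α) = bil α z + c * bil α α := by intro c; simp [bil]; ring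
  have h0 : bil α (z + (-(n:ℂ)) • α) = 0 := by rw [hadd, hb, hn]; ring
  rcases lt_trichotomy n 0 with h1 | h1 | h1
  · obtain ⟨s, rfl⟩ := Int.exists_eq_neg_ofNat h1.le
    have := hp.1 α hα s (by simp at h1; omega) (by simpa using hn2) _ h0
    rw [hn]
    push_cast at this ⊢
    convert this.symm using 2 <;> module
  · subst h1; rw [hn]; simp
  · obtain ⟨s, rfl⟩ := Int.eq_ofNat_of_zero_le h1.le
    have := hp.1 α hα s (by simp at h1; omega) (by simpa using hn2) _ h0
    rw [hn]
    push_cast at this ⊢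
    convert this using 2 <;> module

theorem refl_conv {m : ℕ} {p : (Fin 2 → ℂ) → ℂ}
    (h1 : ∀ α ∈ [vα₁, vα₂, vα₃], ∀ z, AL m (bil α z) → p z = p (z - (2 / 3 * bil α z) • α))
    (h2 : ∀ β ∈ [vβ₁, vβ₂, vβ₃], ∀ z, AS m (bil β z) → p z = p (z - (2 * bil β z) • β))
    (n1 : ∀ α ∈ [vα₁, vα₂, vα₃], bil α α = 3) (n2 : ∀ β ∈ [vβ₁, vβ₂, vβ₃], bil β β = 1) : QuasiInvAG2 m p := by
  constructor
  · intro α hα s hs hsm z hz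
    have e : bil α (z + (s:ℂ) • α) = 3 * s := by
      have : bil α (z + (s:ℂ) • α) = bil α z + s * bil α α := by simp [bil]; ring
      rw [this, hz, n1 α hα]; ring
    rw [h1 α hα _ ⟨s, by rw [e]; simp, by simpa using hsm⟩, e]
    congr 1; module
  · intro β hβ s hs z hz
    have e : bil β (z + (s:ℂ) • β) = s := by
      have : bil β (z + (s:ℂ) • β) = bil β z + s * bil β β := by simp [bil]; ring
      rw [this, hz, n2 β hβ]; ring
    rw [h2 β hβ _ ⟨s, by rw [e]; simp, by simp; omega⟩, e]
    congr 1; module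

theorem nn1 : ∀ α ∈ [vα₁, vα₂, vα₃], bil α α = 3 := by
  intro α hα
  simp only [List.mem_cons, List.not_mem_nil, or_false] at hα
  rcases hα with rfl | rfl | rfl <;> simp only [az1, az2, az3, xa1, xa2, xa3, ya1, ya2, ya3] <;> norm_num
theorem nn2 : ∀ β ∈ [vβ₁, vβ₂, vβ₃], bil β β = 1 := by
  intro α hα
  simp only [List.mem_cons, List.not_mem_nil, or_false] at hα
  rcases hα with rfl | rfl | rfl <;> simp only [bz1, bz2, bz3, xb1, xb3, yb2, yb3] <;> norm_num

theorem Ph_sub (z g : Fin 2 → ℂ) (c : ℂ) : Ph (z - c • g) = (cx z - c * cx g, cy z - c * cy g) := by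
  simp [Ph, cx_sub, cy_sub, cx_smul, cy_smul]

theorem qc_of {m : ℕ} {P : ℂ × ℂ → ℂ} (hp : QuasiInvAG2 m (fun z => P (Ph z))) : QC m P := by
  have hS : ∀ β ∈ [vβ₁, vβ₂, vβ₃], ∀ z, AS m (bil β z) → P (cx z, cy z) = P (cx z - 2 * bil β z * cx β, cy z - 2 * bil β z * cy β) := fun β hβ z hz => by
    have := refl_short hp hβ (nn2 β hβ) hz
    rwa [Ph_sub] at this
  have hL : ∀ α ∈ [vα₁, vα₂, vα₃], ∀ z, AL m (bil α z) → P (cx z, cy z) = P (cx z - 2 / 3 * bil α z * cx α, cy z - 2 / 3 * bil α z * cy α) := fun α hα z hz => by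
    have := refl_long hp hα (nn1 α hα) hz
    rwa [Ph_sub] at this
  have ex : ∀ x y, cx (Ps (x, y)) = x := fun x y => congrArg Prod.fst (Ph_Ps (x, y))
  have ey : ∀ x y, cy (Ps (x, y)) = y := fun x y => congrArg Prod.snd (Ph_Ps (x, y))
  refine ⟨fun x y h => ?_, fun x y h => ?_, fun x y h => ?_, fun x y h => ?_, fun x y h => ?_, fun x y h => ?_⟩
  · have := hS vβ₁ (by simp) (Ps (x, y)) (by rw [bz1, ex]; exact h)
    simp only [bz1, ex, ey, xb1, yb1] at this
    rw [this]; congr 2 <;> ring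
  · have := hS vβ₃ (by simp) (Ps (y, y - x)) (by rw [bz3, ex, ey, show y - x - y = -x by ring]; exact h.neg)
    simp only [bz3, ex, ey, xb3, yb3] at this
    simp only [Function.comp, rR]
    rw [this]; congr 2 <;> ring
  · have := hS vβ₂ (by simp) (Ps (y - x, -x)) (by rw [bz2, ey]; exact h.neg)
    simp only [bz2, ex, ey, xb2, yb2] at this
    simp only [Function.comp, rR]
    rw [show y - x - y = -x by ring, this]; congr 2 <;> ring
  · have := hL vα₃ (by simp) (Ps (x, y)) (by rw [az3, ex, ey]; exact h)
    simp only [az3, ex, ey, xa3, ya3] at this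
    rw [this]; congr 2 <;> ring
  · have := hL vα₂ (by simp) (Ps (y, y - x)) (by
      rw [az2, ex, ey, show y - x - 2 * y = -(x + y) by ring]; exact h.neg)
    simp only [az2, ex, ey, xa2, ya2] at this
    simp only [Function.comp, rR]
    rw [this]; congr 2 <;> ring
  · have := hL vα₁ (by simp) (Ps (y - x, -x)) (by
      rw [az1, ex, ey, show 2 * -x - (y - x) = -(x + y) by ring]; exact h.neg)
    simp only [az1, ex, ey, xa1, ya1] at this
    simp only [Function.comp, rR]
    rw [show y - x - y = -x by ring, this]; congr 2 <;> ring

theorem of_qc {m : ℕ} {P : ℂ × ℂ → ℂ} (hp : QC m P) : QuasiInvAG2 m (fun z => P (Ph z)) := by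
  refine refl_conv (fun α hα z hz => ?_) (fun β hβ z hz => ?_) nn1 nn2
  · simp only [List.mem_cons, List.not_mem_nil, or_false] at hα
    rw [Ph_sub]
    rcases hα with rfl | rfl | rfl
    · rw [az1] at hz
      have := hp.a2 (-cy z) (cx z - cy z) (by rw [show -cy z + (cx z - cy z) = -(2 * cy z - cx z) by ring]; exact hz.neg)
      simp only [Function.comp, rR] at this
      rw [az1, xa1, ya1]
      convert this using 2
      · simp only [Ph]; congr 1 <;> ring
      · congr 1 <;> ring
    · rw [az2] at hz
      have := hp.a1 (cx z - cy z) (cx z) (by rw [show cx z - cy z + cx z = -(cy z - 2 * cx z) by ring]; exact hz.neg)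
      simp only [Function.comp, rR] at this
      rw [az2, xa2, ya2]
      convert this using 2
      · simp only [Ph]; congr 1; ring
      · congr 1 <;> ring
    · rw [az3] at hz
      have := hp.a0 (cx z) (cy z) hz
      rw [az3, xa3, ya3]
      refine Eq.trans (show P (Ph z) = _ from this) ?_
      congr 2 <;> ring
  · simp only [List.mem_cons, List.not_mem_nil, or_false] at hβ
    rw [Ph_sub]
    rcases hβ with rfl | rfl | rfl
    · rw [bz1] at hz
      have := hp.b0 (cx z) (cy z) hz
      rw [bz1, xb1, yb1]
      refine Eq.trans (show P (Ph z) = _ from this) ?_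
      congr 2 <;> ring
    · rw [bz2] at hz
      have := hp.b2 (-cy z) (cx z - cy z) hz.neg
      simp only [Function.comp, rR] at this
      rw [bz2, xb2, yb2]
      convert this using 2
      · simp only [Ph]; congr 1 <;> ring
      · congr 1 <;> ring
    · rw [bz3] at hz
      have := hp.b1 (cx z - cy z) (cx z) (by rw [show cx z - cy z = -(cy z - cx z) by ring]; exact hz.neg)
      simp only [Function.comp, rR] at this
      rw [bz3, xb3, yb3]
      convert this using 2
      · simp only [Ph]; congr 1; ring
      · congr 1 <;> ring

theorem Ph_an (z : Fin 2 → ℂ) : AnalyticAt ℂ Ph z := by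
  have h0 : AnalyticAt ℂ (fun z : Fin 2 → ℂ => z 0) z :=
    (ContinuousLinearMap.proj (R := ℂ) (φ := fun _ : Fin 2 => ℂ) 0).analyticAt z
  have h1 : AnalyticAt ℂ (fun z : Fin 2 → ℂ => z 1) z :=
    (ContinuousLinearMap.proj (R := ℂ) (φ := fun _ : Fin 2 => ℂ) 1).analyticAt z
  unfold Ph cx cy
  exact h0.prod ((h0.div analyticAt_const two_ne_zero).add (analyticAt_const.mul h1))

theorem Ps_an (w : ℂ × ℂ) : AnalyticAt ℂ Ps w := by
  have h1 : AnalyticAt ℂ (fun z : ℂ × ℂ => z.1) w := analyticAt_fst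
  have h2 : AnalyticAt ℂ (fun z : ℂ × ℂ => z.2) w := analyticAt_snd
  rw [analyticAt_pi_iff]
  intro i
  fin_cases i
  · simpa [Ps] using h1
  · simp only [Ps]
    simp
    fun_prop

theorem stmt_9 (m : ℕ) (hm : 1 ≤ m) (p : (Fin 2 → ℂ) → ℂ) (hp : RaAG2 m p) :
    ∃ q : (Fin 2 → ℂ) → ℂ, RaAG2 m q ∧
      ∀ z : Fin 2 → ℂ, D1Reg z → q z = applyD1 m p z := by
  have e : (fun z => (p ∘ Ps) (Ph z)) = p := by funext z; simp [Ps_Ph]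
  have hP : ∀ w, AnalyticAt ℂ (p ∘ Ps) w := fun w => (hp.1 _).comp (Ps_an w)
  obtain ⟨q, hqa, hqc, hqe⟩ := main_xy hm hP (qc_of (by rw [e]; exact hp.2))
  refine ⟨fun z => q (Ph z), ⟨fun z => ?_, of_qc hqc⟩, fun z hz => ?_⟩
  · exact AnalyticAt.fun_comp (hqa _) (Ph_an z)
  · have h1 := applyD1_eq m (p ∘ Ps) hz.reg
    rw [e] at h1
    rw [h1]
    exact hqe _ _ hz.reg

end
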